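/- arXiv:math-ph/0610026 — 9 statements merged into one kernel-verified Lean document; each statement's English description precedes it below -/
import Mathlib

section
/- Let d ≥ 1, let m : ℤ^d → [0,∞) satisfy 0 < ∑_{x∈ℤ^d} m(x) < ∞, and let g : ℤ^d × ℤ^d → ℝ satisfy c ≤ g(x,y) ≤ C for all x,y ∈ ℤ^d, for some constants 0 < c ≤ C < ∞. Then the limit lim_{N→∞} (1/N)·log[ (1/N!) ∑_{σ ∈ Sym_N} ∑_{x₁∈ℤ^d} ⋯ ∑_{x_N∈ℤ^d} ∏_{i=1}^N m(x_i)·g(x_i, x_{σ(i)}) ] exists and equals −inf{ H(Q|Q⁽¹⁾⊗m) − ∑_{x,y∈ℤ^d} Q(x,y)·log g(x,y) : Q a pair probability measure on ℤ^d×ℤ^d with equal marginals }, where Sym_N denotes the set of permutations of {1,…,N}. -/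
open scoped BigOperators

/-- First marginal of a pair (sub)probability measure. -/
noncomputable def margin1 {S : Type*} (Q : S × S → ℝ) (x : S) : ℝ := ∑' y, Q (x, y)

/-- Second marginal of a pair (sub)probability measure. -/
noncomputable def margin2 {S : Type*} (Q : S × S → ℝ) (y : S) : ℝ := ∑' x, Q (x, y)

/-- `Q` is a pair probability measure: values in `[0,1]` and total mass `1`. -/
def IsPairPM {S : Type*} (Q : S × S → ℝ) : Prop :=
  (∀ p, 0 ≤ Q p ∧ Q p ≤ 1) ∧ HasSum Q 1

/-- `Q` has equal first and second marginals. -/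
def EqMarg {S : Type*} (Q : S × S → ℝ) : Prop := margin1 Q = margin2 Q

open Classical in
/-- Relative entropy `H(Q | Q⁽¹⁾ ⊗ m)`, with value `⊤` when `Q` charges a pair where
`Q⁽¹⁾(x)·m(y) = 0`, or when the defining series fails to be summable. -/
noncomputable def relEntropy {S : Type*} (Q : S × S → ℝ) (m : S → ℝ) : EReal :=
  if (∀ p : S × S, 0 < Q p → margin1 Q p.1 * m p.2 ≠ 0) ∧
     Summable (fun p : S × S => Q p * Real.log (Q p / (margin1 Q p.1 * m p.2)))
  then ((∑' p : S × S, Q p * Real.log (Q p / (margin1 Q p.1 * m p.2)) : ℝ) : EReal)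
  else ⊤

open scoped ENNReal

/-- A kernel `g` bounded between positive constants, integrated against a finite nonzero
measure `m`, has a positive eigenvalue with an eigenfunction bounded away from `0` and `∞`. -/
theorem exists_eigenfunction {S : Type*} {m : S → ℝ} (hm0 : ∀ x, 0 ≤ m x) (hms : Summable m)
    (hmpos : 0 < ∑' x, m x) {g : S × S → ℝ} {c C : ℝ} (hc : 0 < c) (hcC : c ≤ C)
    (hgl : ∀ p, c ≤ g p) (hgu : ∀ p, g p ≤ C) :
    ∃ lam : ℝ, 0 < lam ∧ ∃ h : S → ℝ, (∀ x, c ≤ h x ∧ h x ≤ C) ∧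
      ∀ x, HasSum (fun y => g (x, y) * m y * h y) (lam * h x) := by
  have hC : 0 < C := hc.trans_le hcC
  have hg0 : ∀ p, 0 < g p := fun p => hc.trans_le (hgl p)
  set M := ∑' x, m x with hM
  have hne : Nonempty S := by
    by_contra hS
    rw [not_nonempty_iff] at hS
    simp [hM] at hmpos
  have smul : ∀ (f : S → ℝ) (B : ℝ), (∀ y, 0 ≤ f y) → (∀ y, f y ≤ B) →
      Summable fun y => m y * f y := fun f B h0 hB =>
    Summable.of_nonneg_of_le (fun y => mul_nonneg (hm0 y) (h0 y))
      (fun y => mul_le_mul_of_nonneg_left (hB y) (hm0 y)) (hms.mul_right B)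
  have gsmul : ∀ (f : S → ℝ) (B : ℝ), (∀ y, 0 ≤ f y) → (∀ y, f y ≤ B) → ∀ x,
      Summable fun y => g (x, y) * m y * f y := fun f B h0 hB x =>
    Summable.of_nonneg_of_le
      (fun y => mul_nonneg (mul_nonneg (hg0 _).le (hm0 y)) (h0 y))
      (fun y => by
        rw [mul_assoc]
        exact mul_le_mul_of_nonneg_right (hgu _) (mul_nonneg (hm0 y) (h0 y)))
      ((smul f B h0 hB).mul_left C)
  have lower : ∀ (f : S → ℝ) (B : ℝ), (∀ y, 0 ≤ f y) → (∀ y, f y ≤ B) → ∀ x,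
      c * ∑' y, m y * f y ≤ ∑' y, g (x, y) * m y * f y := fun f B h0 hB x => by
    rw [← tsum_mul_left]
    refine Summable.tsum_le_tsum (fun y => ?_) ((smul f B h0 hB).mul_left c) (gsmul f B h0 hB x)
    rw [mul_assoc]
    exact mul_le_mul_of_nonneg_right (hgl _) (mul_nonneg (hm0 y) (h0 y))
  have upper : ∀ (f : S → ℝ) (B : ℝ), (∀ y, 0 ≤ f y) → (∀ y, f y ≤ B) → ∀ x,
      ∑' y, g (x, y) * m y * f y ≤ C * ∑' y, m y * f y := fun f B h0 hB x => by
    rw [← tsum_mul_left]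
    refine Summable.tsum_le_tsum (fun y => ?_) (gsmul f B h0 hB x) ((smul f B h0 hB).mul_left C)
    rw [mul_assoc]
    exact mul_le_mul_of_nonneg_right (hgu _) (mul_nonneg (hm0 y) (h0 y))
  have mass_le : ∀ f : S → ℝ, (∀ y, 0 ≤ f y) → (∀ y, f y ≤ C) → ∑' y, m y * f y ≤ M * C :=
    fun f h0 hB => by
      rw [hM, ← tsum_mul_right]
      exact Summable.tsum_le_tsum (fun y => mul_le_mul_of_nonneg_left (hB y) (hm0 y))
        (smul f C h0 hB) (hms.mul_right C)
  have le_mass : ∀ f : S → ℝ, (∀ y, c ≤ f y) → (∀ y, f y ≤ C) → M * c ≤ ∑' y, m y * f y :=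
    fun f h0 hB => by
      rw [hM, ← tsum_mul_right]
      exact Summable.tsum_le_tsum (fun y => mul_le_mul_of_nonneg_left (h0 y) (hm0 y))
        (hms.mul_right c) (smul f C (fun y => hc.le.trans (h0 y)) hB)
  set D : Set (S → ℝ) := Set.univ.pi fun _ => Set.Icc c C with hD
  set T : S → (S → ℝ) → ℝ := fun x h => ∑' y, g (x, y) * m y * max c (min C (h y)) with hT
  have hTcont : ∀ x, Continuous (T x) := fun x => by
    refine continuous_tsum (u := fun y => C * m y * C) (fun y => by fun_prop)
      ((hms.mul_left C).mul_right C) (fun y h => ?_)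
    have h1 : 0 ≤ max c (min C (h y)) := hc.le.trans (le_max_left _ _)
    have h2 : max c (min C (h y)) ≤ C := max_le hcC (min_le_left _ _)
    rw [Real.norm_of_nonneg (mul_nonneg (mul_nonneg (hg0 _).le (hm0 y)) h1)]
    have := hm0 y
    have := hgu (x, y)
    gcongr
  have hTD : ∀ h ∈ D, ∀ x, T x h = ∑' y, g (x, y) * m y * h y := fun h hh x => by
    refine tsum_congr fun y => ?_
    have := hh y (Set.mem_univ y)
    rw [min_eq_right this.2, max_eq_right this.1]
  set F : Set (ℝ × (S → ℝ)) :=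
    (Set.Icc 0 (C * (M * C) / c) ×ˢ D) ∩ ⋂ x, {p | p.1 * p.2 x ≤ T x p.2} with hF
  have hFc : IsCompact F := by
    refine (isCompact_Icc.prod (isCompact_univ_pi fun _ => isCompact_Icc)).inter_right
      (isClosed_iInter fun x => ?_)
    exact isClosed_le (by fun_prop) ((hTcont x).comp continuous_snd)
  have memF : ∀ (l : ℝ) (h : S → ℝ), 0 ≤ l → (∀ y, c ≤ h y) → (∀ y, h y ≤ C) →
      (∀ x, l * h x ≤ ∑' y, g (x, y) * m y * h y) → (l, h) ∈ F := fun l h hl h1 h2 h3 => by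
    have hhD : h ∈ D := fun y _ => ⟨h1 y, h2 y⟩
    have h0 : ∀ y, 0 ≤ h y := fun y => hc.le.trans (h1 y)
    refine ⟨⟨⟨hl, ?_⟩, hhD⟩, Set.mem_iInter.2 fun x => ?_⟩
    · obtain ⟨x⟩ := hne
      rw [le_div_iff₀ hc]
      calc l * c ≤ l * h x := mul_le_mul_of_nonneg_left (h1 x) hl
        _ ≤ _ := h3 x
        _ ≤ _ := upper h C h0 h2 x
        _ ≤ _ := mul_le_mul_of_nonneg_left (mass_le h h0 h2) hC.le
    · change l * h x ≤ T x h
      rw [hTD h hhD]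
      exact h3 x
  have hconst : (c * M, fun _ : S => c) ∈ F := by
    refine memF _ _ (by positivity) (fun _ => le_rfl) (fun _ => hcC) fun x => ?_
    have := lower (fun _ => c) c (fun _ => hc.le) (fun _ => le_rfl) x
    rw [tsum_mul_right] at this
    linarith
  obtain ⟨⟨lam, h⟩, hhF, hmax⟩ := hFc.exists_isMaxOn ⟨_, hconst⟩ continuous_fst.continuousOn
  have hlam : 0 < lam := (mul_pos hc hmpos).trans_le (hmax hconst)
  have hhD : h ∈ D := hhF.1.2
  have h1 : ∀ y, c ≤ h y := fun y => (hhD y (Set.mem_univ y)).1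
  have h2 : ∀ y, h y ≤ C := fun y => (hhD y (Set.mem_univ y)).2
  have h0 : ∀ y, 0 ≤ h y := fun y => hc.le.trans (h1 y)
  have h3 : ∀ x, lam * h x ≤ ∑' y, g (x, y) * m y * h y := fun x => by
    rw [← hTD h hhD]
    exact Set.mem_iInter.1 hhF.2 x
  set s := ∑' y, m y * h y with hs
  have hspos : 0 < s := (mul_pos hmpos hc).trans_le (le_mass h h1 h2)
  set k : S → ℝ := fun x => ∑' y, g (x, y) * m y * h y with hk
  have hk1 : ∀ x, c * s ≤ k x := lower h C h0 h2
  have hk2 : ∀ x, k x ≤ C * s := upper h C h0 h2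
  have hk0 : ∀ x, 0 ≤ k x := fun x => (mul_pos hc hspos).le.trans (hk1 x)
  set f : S → ℝ := fun x => k x - lam * h x with hf
  have hf0 : ∀ x, 0 ≤ f x := fun x => sub_nonneg.2 (h3 x)
  have hf2 : ∀ x, f x ≤ C * s := fun x =>
    (sub_le_self _ (mul_nonneg hlam.le (h0 x))).trans (hk2 x)
  have hKk : ∀ x, ∑' y, g (x, y) * m y * k y = lam * k x + ∑' y, g (x, y) * m y * f y := fun x => by
    rw [hk, ← tsum_mul_left, ← Summable.tsum_add ((gsmul h C h0 h2 x).mul_left lam)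
      (gsmul f _ hf0 hf2 x)]
    refine tsum_congr fun y => ?_
    simp only [hf, hk]
    ring
  have hk'1 : ∀ y, c ≤ k y / s := fun y => (le_div_iff₀ hspos).2 (hk1 y)
  have hk'2 : ∀ y, k y / s ≤ C := fun y => (div_le_iff₀ hspos).2 (hk2 y)
  have hKk' : ∀ x, ∑' y, g (x, y) * m y * (k y / s) =
      lam * (k x / s) + (∑' y, g (x, y) * m y * f y) / s := fun x => by
    simp_rw [← mul_div_assoc]
    rw [tsum_div_const, hKk, add_div]
  have hmf : ∑' y, m y * f y = 0 := by
    by_contra hne0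
    have hpos : 0 < ∑' y, m y * f y :=
      lt_of_le_of_ne (tsum_nonneg fun y => mul_nonneg (hm0 y) (hf0 y)) (Ne.symm hne0)
    set e := c * (∑' y, m y * f y) / s / C with he
    have hepos : 0 < e := by positivity
    have : (lam + e, fun y => k y / s) ∈ F := by
      refine memF _ _ (by positivity) hk'1 hk'2 fun x => ?_
      rw [hKk', add_mul]
      gcongr
      calc e * (k x / s) ≤ e * C := mul_le_mul_of_nonneg_left (hk'2 x) hepos.le
        _ = c * (∑' y, m y * f y) / s := div_mul_cancel₀ _ hC.ne'
        _ ≤ _ := div_le_div_of_nonneg_right (lower f _ hf0 hf2 x) hspos.le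
    have : lam + e ≤ lam := hmax this
    linarith
  refine ⟨lam, hlam, fun y => k y / s, fun y => ⟨hk'1 y, hk'2 y⟩, fun x => ?_⟩
  have hKf : ∑' y, g (x, y) * m y * f y = 0 := le_antisymm
    (by simpa [hmf] using upper f _ hf0 hf2 x)
    (tsum_nonneg fun y => mul_nonneg (mul_nonneg (hg0 _).le (hm0 y)) (hf0 y))
  have := (gsmul _ C (fun y => hc.le.trans (hk'1 y)) hk'2 x).hasSum
  rwa [hKk', hKf, zero_div, add_zero] at this

/-- A Markov kernel minorised by a multiple of a probability measure has an invariant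
probability measure. -/
theorem exists_invariant {S : Type*} {P : S → S → ℝ≥0∞} {ν : S → ℝ≥0∞} {b : ℝ≥0∞}
    (hP : ∀ x, ∑' y, P x y = 1) (hν : ∑' y, ν y = 1) (hb : b ≠ 0) (hS : Nonempty S)
    (hle : ∀ x y, b * ν y ≤ P x y) :
    ∃ π : S → ℝ≥0∞, ∑' x, π x = 1 ∧ ∀ y, ∑' x, π x * P x y = π y := by
  set R : S → S → ℝ≥0∞ := fun x y => P x y - b * ν y with hR
  have hRP : ∀ x y, R x y + b * ν y = P x y := fun x y => tsub_add_cancel_of_le (hle x y)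
  have hRb : ∀ x, ∑' y, R x y + b = 1 := fun x => by
    rw [← hP x, ← mul_one b, ← hν, ← ENNReal.tsum_mul_left, ← ENNReal.tsum_add]
    exact tsum_congr fun y => hRP x y
  have hb1 : b ≤ 1 := by
    obtain ⟨x⟩ := hS
    rw [← hRb x]
    exact le_add_self
  have hbt : b ≠ ⊤ := ne_top_of_le_ne_top ENNReal.one_ne_top hb1
  have hRs : ∀ x, ∑' y, R x y = 1 - b := fun x => ENNReal.eq_sub_of_add_eq hbt (hRb x)
  let μ : ℕ → S → ℝ≥0∞ := fun n =>
    Nat.rec (fun y => b * ν y) (fun _ u y => ∑' x, u x * R x y) n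
  have hμs : ∀ n y, μ (n + 1) y = ∑' x, μ n x * R x y := fun n y => rfl
  have hmass : ∀ n, ∑' y, μ n y = b * (1 - b) ^ n := fun n => by
    induction n with
    | zero => simp [μ, ENNReal.tsum_mul_left, hν]
    | succ n ih =>
      simp_rw [hμs]
      rw [ENNReal.tsum_comm]
      simp_rw [ENNReal.tsum_mul_left, hRs]
      rw [ENNReal.tsum_mul_right, ih, pow_succ, mul_assoc]
  have hone : ∑' x, ∑' n, μ n x = 1 := by
    rw [ENNReal.tsum_comm]
    simp_rw [hmass]
    rw [ENNReal.tsum_mul_left, ENNReal.tsum_geometric,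
      ENNReal.sub_sub_cancel ENNReal.one_ne_top hb1, ENNReal.mul_inv_cancel hb hbt]
  refine ⟨fun x => ∑' n, μ n x, hone, fun y => ?_⟩
  simp_rw [← hRP, mul_add]
  rw [ENNReal.tsum_add, ENNReal.tsum_mul_right, hone, one_mul]
  simp_rw [← ENNReal.tsum_mul_right]
  rw [ENNReal.tsum_comm]
  simp_rw [← hμs]
  rw [tsum_eq_zero_add' (f := fun n => μ n y) ENNReal.summable, add_comm]
  rfl

/-- The sum over permutations `σ` and configurations `x` of the products of `P i (x i) (x (σ i))`. -/
noncomputable def permSum {S : Type*} (N : ℕ) (P : Fin N → S → S → ℝ≥0∞) : ℝ≥0∞ :=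
  ∑ σ : Equiv.Perm (Fin N), ∑' x : Fin N → S, ∏ i, P i (x i) (x (σ i))

/-- Removing the first index: it is either a fixed point, or it sits between some `k` and the
image of `k`, in which case its kernel is composed with the kernel of `k`. -/
theorem permSum_succ {S : Type*} (N : ℕ) (P : Fin (N + 1) → S → S → ℝ≥0∞) :
    permSum (N + 1) P = (∑' z, P 0 z z) * permSum N (fun i => P i.succ) +
      ∑ k : Fin N, permSum N (Function.update (fun i => P i.succ) k
        (fun x y => ∑' z, P k.succ x z * P 0 z y)) := by
  have key : ∀ (p : Fin (N + 1)) (e : Equiv.Perm (Fin N)),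
      ∑' x : Fin (N + 1) → S, ∏ i, P i (x i) (x (Equiv.Perm.decomposeFin.symm (p, e) i)) =
      ∑' x : Fin N → S, ∑' z, P 0 z (Fin.cons (α := fun _ => S) z x p) *
        ∏ i, P i.succ (x i) (Fin.cons (α := fun _ => S) z x (Equiv.swap 0 p (e i).succ)) := by
    intro p e
    rw [← (Fin.consEquiv fun _ : Fin (N + 1) => S).tsum_eq, ENNReal.tsum_prod', ENNReal.tsum_comm]
    refine tsum_congr fun x => tsum_congr fun z => ?_
    rw [Fin.prod_univ_succ]
    simp [Fin.consEquiv]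
  unfold permSum
  rw [← Equiv.Perm.decomposeFin.symm.sum_comp, Fintype.sum_prod_type]
  simp_rw [key]
  rw [Fin.sum_univ_succ]
  congr 1
  · rw [Finset.mul_sum]
    refine Finset.sum_congr rfl fun e _ => ?_
    simp [ENNReal.tsum_mul_right, ENNReal.tsum_mul_left]
  · rw [Finset.sum_comm, Finset.sum_comm (s := Finset.univ (α := Fin N))]
    refine Finset.sum_congr rfl fun e _ => ?_
    rw [← Equiv.sum_comp e]
    refine Finset.sum_congr rfl fun k _ => tsum_congr fun x => ?_
    rw [← Finset.mul_prod_erase _ _ (Finset.mem_univ k), Function.update_self,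
      ← ENNReal.tsum_mul_right]
    refine tsum_congr fun z => ?_
    rw [← Finset.mul_prod_erase _ _ (Finset.mem_univ k), Equiv.swap_apply_right, Fin.cons_zero,
      Fin.cons_succ, ← mul_assoc, mul_comm (P 0 z _)]
    congr 1
    refine Finset.prod_congr rfl fun i hi => ?_
    have hik : i ≠ k := Finset.ne_of_mem_erase hi
    rw [Function.update_of_ne hik, Equiv.swap_apply_of_ne_of_ne (Fin.succ_ne_zero _)
      (fun h => hik (e.injective (Fin.succ_injective _ h))), Fin.cons_succ]

theorem permSum_le {S : Type*} {ν : S → ℝ≥0∞} {B : ℝ≥0∞} (hν : ∑' y, ν y = 1) (N : ℕ)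
    (P : Fin N → S → S → ℝ≥0∞) (hP : ∀ i x, ∑' y, P i x y = 1)
    (hle : ∀ i x y, P i x y ≤ B * ν y) :
    permSum N P ≤ ∏ k ∈ Finset.range N, (B + k) := by
  induction N with
  | zero => simp [permSum]
  | succ N ih =>
    rw [permSum_succ, Finset.prod_range_succ, mul_add]
    have hdiag : ∑' z, P 0 z z ≤ B := by
      calc ∑' z, P 0 z z ≤ ∑' z, B * ν z := ENNReal.tsum_le_tsum fun z => hle 0 z z
        _ = B := by rw [ENNReal.tsum_mul_left, hν, mul_one]
    refine add_le_add ?_ ?_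
    · rw [mul_comm]
      exact mul_le_mul' (ih _ (fun i => hP i.succ) fun i => hle i.succ) hdiag
    · refine (Finset.sum_le_sum (g := fun _ => ∏ k ∈ Finset.range N, (B + k))
        fun k _ => ih _ (fun i x => ?_) fun i x y => ?_).trans ?_
      · rcases eq_or_ne i k with rfl | h
        · rw [Function.update_self, ENNReal.tsum_comm]
          simp_rw [ENNReal.tsum_mul_left, hP, mul_one]
          exact hP _ x
        · rw [Function.update_of_ne h]
          exact hP _ x
      · rcases eq_or_ne i k with rfl | h
        · rw [Function.update_self]
          calc ∑' z, P i.succ x z * P 0 z y ≤ ∑' z, P i.succ x z * (B * ν y) :=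
                ENNReal.tsum_le_tsum fun z => mul_le_mul_right (hle 0 z y) _
            _ = B * ν y := by rw [ENNReal.tsum_mul_right, hP, one_mul]
        · rw [Function.update_of_ne h]
          exact hle _ x y
      · simp [mul_comm]

theorem le_permSum {S : Type*} {ν : S → ℝ≥0∞} {b : ℝ≥0∞} (hν : ∑' y, ν y = 1) (N : ℕ)
    (P : Fin N → S → S → ℝ≥0∞) (hP : ∀ i x, ∑' y, P i x y = 1)
    (hle : ∀ i x y, b * ν y ≤ P i x y) :
    ∏ k ∈ Finset.range N, (b + k) ≤ permSum N P := by
  induction N with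
  | zero => simp [permSum]
  | succ N ih =>
    rw [permSum_succ, Finset.prod_range_succ, mul_comm, add_mul]
    have hdiag : b ≤ ∑' z, P 0 z z := by
      calc b = ∑' z, b * ν z := by rw [ENNReal.tsum_mul_left, hν, mul_one]
        _ ≤ ∑' z, P 0 z z := ENNReal.tsum_le_tsum fun z => hle 0 z z
    refine add_le_add ?_ ?_
    · exact mul_le_mul' hdiag (ih _ (fun i => hP i.succ) fun i => hle i.succ)
    · refine le_trans ?_ (Finset.sum_le_sum (f := fun _ => ∏ k ∈ Finset.range N, (b + k))
        fun k _ => ih _ (fun i x => ?_) fun i x y => ?_)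
      · simp
      · rcases eq_or_ne i k with rfl | h
        · rw [Function.update_self, ENNReal.tsum_comm]
          simp_rw [ENNReal.tsum_mul_left, hP, mul_one]
          exact hP _ x
        · rw [Function.update_of_ne h]
          exact hP _ x
      · rcases eq_or_ne i k with rfl | h
        · rw [Function.update_self]
          calc b * ν y = ∑' z, P i.succ x z * (b * ν y) := by
                rw [ENNReal.tsum_mul_right, hP, one_mul]
            _ ≤ ∑' z, P i.succ x z * P 0 z y :=
                ENNReal.tsum_le_tsum fun z => mul_le_mul_right (hle 0 z y) _
        · rw [Function.update_of_ne h]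
          exact hle _ x y

/-- `∏ (a + k)` over `k < N` agrees with `N!` to exponential order. -/
theorem tendsto_log_prod_div_factorial {a : ℝ} (ha : 0 < a) :
    Filter.Tendsto (fun N : ℕ => (1 / (N : ℝ)) *
      Real.log ((∏ k ∈ Finset.range N, (a + k)) / (N.factorial : ℝ))) Filter.atTop (nhds 0) := by
  have hterm : Filter.Tendsto (fun k : ℕ => Real.log ((a + k) / (k + 1))) Filter.atTop
      (nhds 0) := by
    have h1 : Filter.Tendsto (fun k : ℕ => 1 + (a - 1) * (1 / ((k : ℝ) + 1))) Filter.atTop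
        (nhds (1 + (a - 1) * 0)) :=
      (tendsto_one_div_add_atTop_nhds_zero_nat.const_mul _).const_add _
    rw [mul_zero, add_zero] at h1
    have h2 := h1.log one_ne_zero
    rw [Real.log_one] at h2
    refine h2.congr fun k => ?_
    congr 1
    have : (k : ℝ) + 1 ≠ 0 := by positivity
    field_simp
    ring
  refine hterm.cesaro.congr fun N => ?_
  rw [one_div, ← Real.log_prod (fun k _ => by positivity), Finset.prod_div_distrib,
    ← Finset.prod_range_add_one_eq_factorial]
  push_cast
  rfl

/-- Pointwise form of the Gibbs inequality. -/
theorem sub_le_mul_log_div {q r : ℝ} (hq : 0 ≤ q) (hr : 0 ≤ r) (hqr : 0 < q → 0 < r) :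
    q - r ≤ q * Real.log (q / r) := by
  rcases hq.eq_or_lt with rfl | hq
  · simpa using hr
  · have hr := hqr hq
    have h := Real.log_le_sub_one_of_pos (div_pos hr hq)
    rw [← inv_div, Real.log_inv] at h
    have h' := mul_le_mul_of_nonneg_left h hq.le
    have : q * (r / q) = r := mul_div_cancel₀ r hq.ne'
    rw [inv_div, mul_sub, this] at h'
    linarith

namespace IsPairPM

variable {S : Type*} {Q : S × S → ℝ}

theorem summable_mul (hQ : IsPairPM Q) {f : S × S → ℝ} {B : ℝ} (hf : ∀ p, |f p| ≤ B) :
    Summable fun p => Q p * f p := by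
  refine Summable.of_norm_bounded (g := fun p => Q p * B) (hQ.2.summable.mul_right B) fun p => ?_
  rw [norm_mul, Real.norm_of_nonneg (hQ.1 p).1]
  exact mul_le_mul_of_nonneg_left (hf p) (hQ.1 p).1

theorem margin1_nonneg (hQ : IsPairPM Q) (x : S) : 0 ≤ margin1 Q x :=
  tsum_nonneg fun y => (hQ.1 (x, y)).1

theorem hasSum_margin1 (hQ : IsPairPM Q) : HasSum (margin1 Q) 1 :=
  hQ.2.prod_fiberwise fun x => (hQ.2.summable.prod_factor x).hasSum

theorem tsum_mul_fst (hQ : IsPairPM Q) {f : S → ℝ} {B : ℝ} (hf : ∀ x, |f x| ≤ B) :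
    ∑' p : S × S, Q p * f p.1 = ∑' x, margin1 Q x * f x := by
  rw [(hQ.summable_mul fun p => hf p.1).tsum_prod]
  refine tsum_congr fun x => ?_
  rw [margin1, ← tsum_mul_right]

theorem tsum_mul_snd (hQ : IsPairPM Q) {f : S → ℝ} {B : ℝ} (hf : ∀ x, |f x| ≤ B) :
    ∑' p : S × S, Q p * f p.2 = ∑' y, margin2 Q y * f y := by
  have hs := hQ.summable_mul fun p => hf p.2
  rw [← (Equiv.prodComm S S).tsum_eq]
  refine ((Equiv.prodComm S S).summable_iff.2 hs).tsum_prod.trans (tsum_congr fun y => ?_)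
  rw [margin2, ← tsum_mul_right]
  rfl

theorem hasSum_mul_coboundary (hQ : IsPairPM Q) (hE : EqMarg Q) {f : S → ℝ} {B : ℝ}
    (hf : ∀ x, |f x| ≤ B) : HasSum (fun p : S × S => Q p * (f p.2 - f p.1)) 0 := by
  have h := (hQ.summable_mul fun p => hf p.2).hasSum.sub (hQ.summable_mul fun p => hf p.1).hasSum
  rw [hQ.tsum_mul_fst hf, hQ.tsum_mul_snd hf, hE, sub_self] at h
  simpa only [mul_sub] using h

end IsPairPM

theorem abs_log_le_of_mem {a c C : ℝ} (hc : 0 < c) (h1 : c ≤ a) (h2 : a ≤ C) :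
    |Real.log a| ≤ max |Real.log c| |Real.log C| :=
  abs_le_max_abs_abs (Real.log_le_log hc h1) (Real.log_le_log (hc.trans_le h1) h2)

/-- The value of the variational problem is at least minus the log of the eigenvalue. -/
theorem neg_log_le_relEntropy_sub {S : Type*} {m : S → ℝ} (hm0 : ∀ x, 0 ≤ m x) {g : S × S → ℝ}
    {c C : ℝ} (hc : 0 < c) (hgl : ∀ p, c ≤ g p) (hgu : ∀ p, g p ≤ C) {lam : ℝ} (hlam : 0 < lam)
    {h : S → ℝ} (hh : ∀ x, c ≤ h x ∧ h x ≤ C)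
    (heig : ∀ x, HasSum (fun y => g (x, y) * m y * h y) (lam * h x))
    {Q : S × S → ℝ} (hQ : IsPairPM Q) (hE : EqMarg Q) :
    ((-Real.log lam : ℝ) : EReal) ≤
      relEntropy Q m - ((∑' p, Q p * Real.log (g p) : ℝ) : EReal) := by
  unfold relEntropy
  split_ifs with hcond
  swap
  · simp
  obtain ⟨hpos, hsum⟩ := hcond
  rw [← EReal.coe_sub, EReal.coe_le_coe_iff]
  have hg0 : ∀ p, 0 < g p := fun p => hc.trans_le (hgl p)
  have hh0 : ∀ x, 0 < h x := fun x => hc.trans_le (hh x).1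
  set P : S × S → ℝ := fun p => g p * m p.2 * h p.2 / (lam * h p.1) with hP
  have hP0 : ∀ p, 0 ≤ P p := fun p => div_nonneg
    (mul_nonneg (mul_nonneg (hg0 p).le (hm0 _)) (hh0 _).le) (mul_pos hlam (hh0 _)).le
  have hPs : ∀ x, HasSum (fun y => P (x, y)) 1 := fun x => by
    have := (heig x).div_const (lam * h x)
    rwa [div_self (mul_pos hlam (hh0 x)).ne'] at this
  have hQP : HasSum (fun p : S × S => margin1 Q p.1 * P p) 1 := by
    have hrow : ∀ x, HasSum (fun y => margin1 Q x * P (x, y)) (margin1 Q x) := fun x => by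
      simpa using (hPs x).mul_left (margin1 Q x)
    have hs : Summable fun p : S × S => margin1 Q p.1 * P p := by
      refine (summable_prod_of_nonneg fun p => mul_nonneg (hQ.margin1_nonneg _) (hP0 p)).2
        ⟨fun x => (hrow x).summable, ?_⟩
      simp_rw [(hrow _).tsum_eq]
      exact hQ.hasSum_margin1.summable
    have := hs.hasSum.prod_fiberwise hrow
    exact hQ.hasSum_margin1.unique this ▸ hs.hasSum
  have hlg := hQ.summable_mul fun p => abs_log_le_of_mem hc (hgl p) (hgu p)
  have hcob := hQ.hasSum_mul_coboundary hE fun x => abs_log_le_of_mem hc (hh x).1 (hh x).2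
  have hlow := (((hQ.2.sub hQP).add hlg.hasSum).add hcob).sub (hQ.2.mul_right (Real.log lam))
  have hle := hasSum_le (fun p => ?_) hlow hsum.hasSum
  · linarith
  · obtain ⟨x, y⟩ := p
    rcases (hQ.1 (x, y)).1.eq_or_lt with h0 | hq
    · have := mul_nonneg (hQ.margin1_nonneg x) (hP0 (x, y))
      simp only [← h0]
      linarith
    · have hne := hpos _ hq
      have h1 : 0 < margin1 Q x :=
        (hQ.margin1_nonneg x).lt_of_ne' (left_ne_zero_of_mul hne)
      have h2 : 0 < m y := (hm0 y).lt_of_ne' (right_ne_zero_of_mul hne)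
      have hg := hg0 (x, y)
      have hx := hh0 x
      have hy := hh0 y
      have hPp : 0 < P (x, y) := by simp only [hP]; positivity
      have := sub_le_mul_log_div hq.le (mul_pos h1 hPp).le fun _ => mul_pos h1 hPp
      have hlog : Real.log (Q (x, y) / (margin1 Q x * P (x, y))) =
          Real.log (Q (x, y) / (margin1 Q x * m y)) - Real.log (g (x, y)) -
            (Real.log (h y) - Real.log (h x)) + Real.log lam := by
        simp only [hP]
        rw [Real.log_div hq.ne' (by positivity), Real.log_div hq.ne' (by positivity),
          Real.log_mul h1.ne' (by positivity), Real.log_mul h1.ne' (by positivity),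
          Real.log_div (by positivity) (by positivity), Real.log_mul (by positivity) (by positivity),
          Real.log_mul (by positivity) (by positivity), Real.log_mul (by positivity) (by positivity)]
        ring
      rw [hlog] at this
      dsimp only
      linarith

/-- The variational problem is solved by the stationary two-step distribution of the Markov
kernel obtained from `g` by the ground state transform. -/
theorem exists_relEntropy_sub_eq {S : Type*} {m : S → ℝ} (hm0 : ∀ x, 0 ≤ m x) {g : S × S → ℝ}
    {c C : ℝ} (hc : 0 < c) (hgl : ∀ p, c ≤ g p) (hgu : ∀ p, g p ≤ C) {lam : ℝ} (hlam : 0 < lam)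
    {h : S → ℝ} (hh : ∀ x, c ≤ h x ∧ h x ≤ C)
    {π : S → ℝ≥0∞} (hπ : ∑' x, π x = 1)
    (hrow : ∀ x, ∑' y, ENNReal.ofReal (g (x, y) * m y * h y / (lam * h x)) = 1)
    (hinv : ∀ y, ∑' x, π x * ENNReal.ofReal (g (x, y) * m y * h y / (lam * h x)) = π y) :
    ∃ Q : S × S → ℝ, IsPairPM Q ∧ EqMarg Q ∧ ((-Real.log lam : ℝ) : EReal) =
      relEntropy Q m - ((∑' p, Q p * Real.log (g p) : ℝ) : EReal) := by
  have hg0 : ∀ p, 0 < g p := fun p => hc.trans_le (hgl p)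
  have hh0 : ∀ x, 0 < h x := fun x => hc.trans_le (hh x).1
  set P : S × S → ℝ := fun p => g p * m p.2 * h p.2 / (lam * h p.1) with hP
  have hP0 : ∀ p, 0 ≤ P p := fun p => div_nonneg
    (mul_nonneg (mul_nonneg (hg0 p).le (hm0 _)) (hh0 _).le) (mul_pos hlam (hh0 _)).le
  have hπt : ∀ x, π x ≠ ⊤ := fun x =>
    ne_top_of_le_ne_top ENNReal.one_ne_top (hπ ▸ ENNReal.le_tsum x)
  have htot : ∑' p : S × S, π p.1 * ENNReal.ofReal (P p) = 1 := by
    rw [ENNReal.tsum_prod', ← hπ]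
    refine tsum_congr fun x => ?_
    dsimp only
    rw [ENNReal.tsum_mul_left]
    exact (congrArg _ (hrow x)).trans (mul_one _)
  set Q : S × S → ℝ := fun p => (π p.1 * ENNReal.ofReal (P p)).toReal with hQdef
  have hQeq : ∀ p, Q p = (π p.1).toReal * P p := fun p => by
    simp only [hQdef]
    rw [ENNReal.toReal_mul, ENNReal.toReal_ofReal (hP0 p)]
  have hQ1 : HasSum Q 1 := by
    have := ENNReal.hasSum_toReal (f := fun p : S × S => π p.1 * ENNReal.ofReal (P p))
      (by rw [htot]; exact ENNReal.one_ne_top)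
    rwa [← ENNReal.tsum_toReal_eq fun p => ENNReal.mul_ne_top (hπt _) ENNReal.ofReal_ne_top, htot,
      ENNReal.toReal_one] at this
  have hQ : IsPairPM Q := ⟨fun p => ⟨ENNReal.toReal_nonneg,
    le_hasSum hQ1 p fun _ _ => ENNReal.toReal_nonneg⟩, hQ1⟩
  have hmarg1 : ∀ x, margin1 Q x = (π x).toReal := fun x => by
    simp only [margin1, hQdef]
    rw [← ENNReal.tsum_toReal_eq fun y => ENNReal.mul_ne_top (hπt _) ENNReal.ofReal_ne_top,
      ENNReal.tsum_mul_left]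
    exact congrArg _ ((congrArg _ (hrow x)).trans (mul_one _))
  have hmarg2 : ∀ y, margin2 Q y = (π y).toReal := fun y => by
    simp only [margin2, hQdef]
    rw [← ENNReal.tsum_toReal_eq fun x => ENNReal.mul_ne_top (hπt _) ENNReal.ofReal_ne_top]
    exact congrArg _ (hinv y)
  have hE : EqMarg Q := funext fun x => (hmarg1 x).trans (hmarg2 x).symm
  have hlg := hQ.summable_mul fun p => abs_log_le_of_mem hc (hgl p) (hgu p)
  have hcob := hQ.hasSum_mul_coboundary hE fun x => abs_log_le_of_mem hc (hh x).1 (hh x).2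
  have hsupp : ∀ p, 0 < Q p → 0 < margin1 Q p.1 ∧ 0 < m p.2 := fun p hp => by
    rw [hmarg1]
    rw [hQeq] at hp
    refine ⟨ENNReal.toReal_nonneg.lt_of_ne' (left_ne_zero_of_mul hp.ne'),
      (hm0 _).lt_of_ne' fun h0 => ?_⟩
    simp [hP, h0] at hp
  have hent : HasSum (fun p : S × S => Q p * Real.log (Q p / (margin1 Q p.1 * m p.2)))
      (∑' p, Q p * Real.log (g p) + 0 - 1 * Real.log lam) := by
    refine ((hlg.hasSum.add hcob).sub (hQ.2.mul_right (Real.log lam))).congr_fun fun p => ?_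
    rcases (hQ.1 p).1.eq_or_lt with h0 | hq
    · simp [← h0]
    · obtain ⟨h1, h2⟩ := hsupp p hq
      have hg := hg0 p
      have hx := hh0 p.1
      have hy := hh0 p.2
      have : Q p / (margin1 Q p.1 * m p.2) = g p * h p.2 / (lam * h p.1) := by
        rw [hQeq, ← hmarg1]
        simp only [hP]
        field_simp
      rw [this, Real.log_div (by positivity) (by positivity), Real.log_mul hg.ne' hy.ne',
        Real.log_mul hlam.ne' hx.ne']
      ring
  refine ⟨Q, hQ, hE, ?_⟩
  unfold relEntropy
  rw [if_pos ⟨fun p hp => (mul_pos (hsupp p hp).1 (hsupp p hp).2).ne', hent.summable⟩,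
    hent.tsum_eq, ← EReal.coe_sub]
  congr 1
  ring

/-- The symmetrised partition function equals `lam ^ N` times the permutation sum of the
transformed kernel. -/
theorem sum_perm_eq_pow_mul_permSum {S : Type*} {m : S → ℝ} (hm0 : ∀ x, 0 ≤ m x) {g : S × S → ℝ}
    (hg0 : ∀ p, 0 < g p) {lam : ℝ} (hlam : 0 < lam) {h : S → ℝ} (hh0 : ∀ x, 0 < h x) (N : ℕ)
    (hfin : permSum N (fun _ x y => ENNReal.ofReal (g (x, y) * m y * h y / (lam * h x))) ≠ ⊤) :
    ∑ σ : Equiv.Perm (Fin N), ∑' x : Fin N → S, ∏ i : Fin N, (m (x i) * g (x i, x (σ i))) =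
      lam ^ N * (permSum N
        (fun _ x y => ENNReal.ofReal (g (x, y) * m y * h y / (lam * h x)))).toReal := by
  unfold permSum at hfin ⊢
  rw [ENNReal.toReal_sum fun σ _ => (ENNReal.sum_ne_top.1 hfin) σ (Finset.mem_univ σ),
    Finset.mul_sum]
  refine Finset.sum_congr rfl fun σ _ => ?_
  rw [ENNReal.tsum_toReal_eq fun x => ENNReal.prod_ne_top fun i _ => ENNReal.ofReal_ne_top,
    ← tsum_mul_left]
  refine tsum_congr fun x => ?_
  have hP0 : ∀ i, 0 ≤ g (x i, x (σ i)) * m (x (σ i)) * h (x (σ i)) / (lam * h (x i)) := fun i =>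
    div_nonneg (mul_nonneg (mul_nonneg (hg0 _).le (hm0 _)) (hh0 _).le) (mul_pos hlam (hh0 _)).le
  have hprod : ∏ i, h (x i) ≠ 0 := Finset.prod_ne_zero_iff.2 fun i _ => (hh0 _).ne'
  rw [← ENNReal.ofReal_prod_of_nonneg fun i _ => hP0 i,
    ENNReal.toReal_ofReal (Finset.prod_nonneg fun i _ => hP0 i), Finset.prod_div_distrib,
    Finset.prod_mul_distrib, Finset.prod_mul_distrib, Finset.prod_mul_distrib,
    Finset.prod_mul_distrib, Equiv.prod_comp σ fun j => m (x j), Equiv.prod_comp σ fun j => h (x j),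
    Finset.prod_const, Finset.card_univ, Fintype.card_fin]
  have := pow_ne_zero N hlam.ne'
  field_simp

/-- asymptotics of the symmetrised partition function with weights
`m` (a finite positive measure on `ℤ^d`) and a bounded kernel `g`. -/
theorem stmt0 (d : ℕ) (hd : 1 ≤ d)
    (m : (Fin d → ℤ) → ℝ) (hm0 : ∀ x, 0 ≤ m x) (hms : Summable m)
    (hmpos : 0 < ∑' x, m x)
    (g : ((Fin d → ℤ) × (Fin d → ℤ)) → ℝ) (c C : ℝ)
    (hc : 0 < c) (hcC : c ≤ C)
    (hgl : ∀ p, c ≤ g p) (hgu : ∀ p, g p ≤ C) :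
    ∃ L : ℝ,
      Filter.Tendsto
        (fun N : ℕ => (1 / (N : ℝ)) *
          Real.log ((1 / (N.factorial : ℝ)) *
            ∑ σ : Equiv.Perm (Fin N),
              ∑' x : Fin N → (Fin d → ℤ),
                ∏ i : Fin N, (m (x i) * g (x i, x (σ i)))))
        Filter.atTop (nhds L) ∧
      (L : EReal) =
        - sInf { r : EReal |
            ∃ Q : ((Fin d → ℤ) × (Fin d → ℤ)) → ℝ,
              IsPairPM Q ∧ EqMarg Q ∧
              r = relEntropy Q m -
                  ((∑' p, Q p * Real.log (g p) : ℝ) : EReal) } := by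
  obtain ⟨lam, hlam, h, hh, heig⟩ := exists_eigenfunction hm0 hms hmpos hc hcC hgl hgu
  have hC : 0 < C := hc.trans_le hcC
  have hg0 : ∀ p, 0 < g p := fun p => hc.trans_le (hgl p)
  have hh0 : ∀ x, 0 < h x := fun x => hc.trans_le (hh x).1
  set M := ∑' x, m x with hM
  set P : (Fin d → ℤ) → (Fin d → ℤ) → ℝ≥0∞ :=
    fun x y => ENNReal.ofReal (g (x, y) * m y * h y / (lam * h x)) with hP
  have hrow : ∀ x, ∑' y, P x y = 1 := fun x => by
    have hs := (heig x).div_const (lam * h x)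
    rw [div_self (mul_pos hlam (hh0 x)).ne'] at hs
    simp only [hP]
    rw [← ENNReal.ofReal_tsum_of_nonneg (fun y => div_nonneg
      (mul_nonneg (mul_nonneg (hg0 _).le (hm0 y)) (hh0 y).le) (mul_pos hlam (hh0 x)).le)
      hs.summable, hs.tsum_eq, ENNReal.ofReal_one]
  set ν : (Fin d → ℤ) → ℝ≥0∞ := fun y => ENNReal.ofReal (m y / M) with hνdef
  have hν : ∑' y, ν y = 1 := by
    have hs := hms.hasSum.div_const M
    rw [← hM, div_self hmpos.ne'] at hs
    simp only [hνdef]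
    rw [← ENNReal.ofReal_tsum_of_nonneg (fun y => div_nonneg (hm0 y) hmpos.le) hs.summable,
      hs.tsum_eq, ENNReal.ofReal_one]
  set b : ℝ := c * c * M / (lam * C) with hb
  set B : ℝ := C * C * M / (lam * c) with hB
  have hbpos : 0 < b := by positivity
  have hBpos : 0 < B := by positivity
  have hlow : ∀ x y, ENNReal.ofReal b * ν y ≤ P x y := fun x y => by
    rw [← ENNReal.ofReal_mul hbpos.le]
    refine ENNReal.ofReal_le_ofReal ?_
    have hmy := hm0 y
    have h1 := hh0 x
    calc b * (m y / M) = c * m y * c / (lam * C) := by rw [hb]; field_simp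
      _ ≤ g (x, y) * m y * h y / (lam * h x) := by
        have := (hh x).2
        have := (hh y).1
        have := hgl (x, y)
        have := hg0 (x, y)
        have := hh0 y
        gcongr
  have hupp : ∀ x y, P x y ≤ ENNReal.ofReal B * ν y := fun x y => by
    rw [← ENNReal.ofReal_mul hBpos.le]
    refine ENNReal.ofReal_le_ofReal ?_
    have hmy := hm0 y
    have h1 := hh0 y
    calc g (x, y) * m y * h y / (lam * h x) ≤ C * m y * C / (lam * c) := by
          have := (hh x).1
          have := (hh y).2
          have := hgu (x, y)
          gcongr
      _ = B * (m y / M) := by rw [hB]; field_simp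
  have hprod : ∀ (a : ℝ), 0 < a → ∀ N : ℕ, ∏ k ∈ Finset.range N, (ENNReal.ofReal a + k) =
      ENNReal.ofReal (∏ k ∈ Finset.range N, (a + k)) := fun a ha N => by
    rw [ENNReal.ofReal_prod_of_nonneg fun k _ => by positivity]
    refine Finset.prod_congr rfl fun k _ => ?_
    rw [ENNReal.ofReal_add ha.le k.cast_nonneg, ENNReal.ofReal_natCast]
  have hW1 : ∀ N : ℕ, permSum N (fun _ => P) ≤ ENNReal.ofReal (∏ k ∈ Finset.range N, (B + k)) :=
    fun N => (permSum_le hν N _ (fun _ => hrow) fun _ => hupp).trans_eq (hprod B hBpos N)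
  have hW2 : ∀ N : ℕ, ENNReal.ofReal (∏ k ∈ Finset.range N, (b + k)) ≤ permSum N (fun _ => P) :=
    fun N => (hprod b hbpos N).symm.trans_le (le_permSum hν N _ (fun _ => hrow) fun _ => hlow)
  have hWt : ∀ N : ℕ, permSum N (fun _ => P) ≠ ⊤ := fun N =>
    ne_top_of_le_ne_top ENNReal.ofReal_ne_top (hW1 N)
  have hbp : ∀ N : ℕ, 0 < ∏ k ∈ Finset.range N, (b + k) := fun N =>
    Finset.prod_pos fun k _ => by positivity
  have hBp : ∀ N : ℕ, 0 < ∏ k ∈ Finset.range N, (B + k) := fun N =>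
    Finset.prod_pos fun k _ => by positivity
  have hR1 : ∀ N : ℕ, (permSum N (fun _ => P)).toReal ≤ ∏ k ∈ Finset.range N, (B + k) :=
    fun N => ENNReal.toReal_le_of_le_ofReal (hBp N).le (hW1 N)
  have hR2 : ∀ N : ℕ, ∏ k ∈ Finset.range N, (b + k) ≤ (permSum N (fun _ => P)).toReal :=
    fun N => (ENNReal.ofReal_le_iff_le_toReal (hWt N)).1 (hW2 N)
  have hf : ∀ N : ℕ, (0 : ℝ) < N.factorial := fun N => by positivity
  have hlim : Filter.Tendsto (fun N : ℕ => (1 / (N : ℝ)) *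
      Real.log ((permSum N (fun _ => P)).toReal / (N.factorial : ℝ))) Filter.atTop (nhds 0) := by
    refine tendsto_of_tendsto_of_tendsto_of_le_of_le (tendsto_log_prod_div_factorial hbpos)
      (tendsto_log_prod_div_factorial hBpos) (fun N => ?_) (fun N => ?_)
    · exact mul_le_mul_of_nonneg_left (Real.log_le_log (div_pos (hbp N) (hf N))
        (div_le_div_of_nonneg_right (hR2 N) (hf N).le)) (by positivity)
    · exact mul_le_mul_of_nonneg_left (Real.log_le_log
        (div_pos ((hbp N).trans_le (hR2 N)) (hf N))
        (div_le_div_of_nonneg_right (hR1 N) (hf N).le)) (by positivity)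
  refine ⟨Real.log lam, ?_, ?_⟩
  · have hlim' := hlim.const_add (Real.log lam)
    rw [add_zero] at hlim'
    refine hlim'.congr' ?_
    filter_upwards [Filter.eventually_gt_atTop 0] with N hN
    have hN' : (N : ℝ) ≠ 0 := by positivity
    rw [sum_perm_eq_pow_mul_permSum hm0 hg0 hlam hh0 N (hWt N),
      one_div_mul_eq_div (N.factorial : ℝ), mul_div_assoc, Real.log_mul (pow_ne_zero N hlam.ne')
        (div_pos ((hbp N).trans_le (hR2 N)) (hf N)).ne', Real.log_pow]
    field_simp
  · obtain ⟨π, hπ, hinv⟩ := exists_invariant hrow hν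
      (ENNReal.ofReal_pos.2 hbpos).ne' inferInstance hlow
    have hleast : IsLeast { r : EReal | ∃ Q : ((Fin d → ℤ) × (Fin d → ℤ)) → ℝ,
        IsPairPM Q ∧ EqMarg Q ∧
        r = relEntropy Q m - ((∑' p, Q p * Real.log (g p) : ℝ) : EReal) }
        ((-Real.log lam : ℝ) : EReal) := by
      refine ⟨exists_relEntropy_sub_eq hm0 hc hgl hgu hlam hh hπ hrow hinv, ?_⟩
      rintro r ⟨Q, hQ, hE, rfl⟩
      exact neg_log_le_relEntropy_sub hm0 hc hgl hgu hlam hh heig hQ hE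
    rw [hleast.csInf_eq, EReal.coe_neg, neg_neg]
end

section
/- Let Q be a pair probability measure on ℤ^d×ℤ^d with equal marginals, let Λ ⊂ ℤ^d be a finite nonempty set and let x₀ ∈ Λ. Define Q_Λ : Λ×Λ → ℝ by: Q_Λ(x,y) = Q(x,y) for x,y ∈ Λ∖{x₀}; Q_Λ(x,x₀) = Q⁽¹⁾(x) − ∑_{z∈Λ∖{x₀}} Q(x,z) for x ∈ Λ∖{x₀}; Q_Λ(x₀,y) = Q⁽¹⁾(y) − ∑_{z∈Λ∖{x₀}} Q(z,y) for y ∈ Λ∖{x₀}; and Q_Λ(x₀,x₀) = 1 − ∑_{(x,y)∈Λ×Λ, (x,y)≠(x₀,x₀)} Q_Λ(x,y). Then Q_Λ is a pair probability measure on Λ×Λ with equal marginals: every entry Q_Λ(x,y) lies in [0,1], ∑_{x,y∈Λ} Q_Λ(x,y) = 1, and ∑_{y∈Λ} Q_Λ(x,y) = ∑_{y∈Λ} Q_Λ(y,x) for every x ∈ Λ. -/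
open scoped BigOperators

/-- The off-corner entries of the marginal construction `Q_Λ`. -/
noncomputable def QLamOff {S : Type*} [DecidableEq S]
    (Q : S × S → ℝ) (Λ : Finset S) (x₀ : S) (p : S × S) : ℝ :=
  if p.1 = x₀ then margin1 Q p.2 - ∑ z ∈ Λ.erase x₀, Q (z, p.2)
  else if p.2 = x₀ then margin1 Q p.1 - ∑ z ∈ Λ.erase x₀, Q (p.1, z)
  else Q p

/-- The marginal construction `Q_Λ`: it agrees with `Q` on `(Λ∖{x₀})²`, its rows and
columns through `x₀` are fixed by the marginals of `Q`, the corner `(x₀,x₀)` makes the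
total mass `1`, and it vanishes outside `Λ×Λ`. -/
noncomputable def QLam {S : Type*} [DecidableEq S]
    (Q : S × S → ℝ) (Λ : Finset S) (x₀ : S) (p : S × S) : ℝ :=
  if p.1 ∈ Λ ∧ p.2 ∈ Λ then
    if p = (x₀, x₀) then 1 - ∑ q ∈ (Λ ×ˢ Λ).erase (x₀, x₀), QLamOff Q Λ x₀ q
    else QLamOff Q Λ x₀ p
  else 0

section PairMeasure

variable {S : Type*} {Q : S × S → ℝ}

lemma IsPairPM.summable_row (hQ : IsPairPM Q) (x : S) : Summable fun y => Q (x, y) :=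
  hQ.2.summable.comp_injective (Prod.mk_right_injective x)

lemma IsPairPM.summable_col (hQ : IsPairPM Q) (y : S) : Summable fun x => Q (x, y) :=
  hQ.2.summable.comp_injective (Prod.mk_left_injective y)

variable [DecidableEq S]

lemma IsPairPM.hasSum_rows (hQ : IsPairPM Q) (B : Finset S) :
    HasSum (fun p : S × S => if p.1 ∈ B then Q p else 0) (∑ x ∈ B, margin1 Q x) := by
  have hrow (b : S) : HasSum (fun p : S × S => if p.1 = b then Q p else 0) (margin1 Q b) := by
    rw [← (Prod.mk_right_injective b).hasSum_iff]
    · simpa [Function.comp_def, margin1] using (hQ.summable_row b).hasSum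
    · rintro ⟨x, y⟩ hp
      exact if_neg fun h => hp ⟨y, by simp_all⟩
  simpa using hasSum_sum fun b (_ : b ∈ B) => hrow b

lemma IsPairPM.hasSum_cols (hQ : IsPairPM Q) (B : Finset S) :
    HasSum (fun p : S × S => if p.2 ∈ B then Q p else 0) (∑ y ∈ B, margin2 Q y) := by
  have hcol (b : S) : HasSum (fun p : S × S => if p.2 = b then Q p else 0) (margin2 Q b) := by
    rw [← (Prod.mk_left_injective b).hasSum_iff]
    · simpa [Function.comp_def, margin2] using (hQ.summable_col b).hasSum
    · rintro ⟨x, y⟩ hp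
      exact if_neg fun h => hp ⟨x, by simp_all⟩
  simpa using hasSum_sum fun b (_ : b ∈ B) => hcol b

/-- Inclusion–exclusion for the mass of the complement of `B × S ∪ S × B`. -/
lemma IsPairPM.mass_compl_nonneg (hQ : IsPairPM Q) (B : Finset S) :
    0 ≤ 1 - ∑ x ∈ B, margin1 Q x - ∑ y ∈ B, margin2 Q y + ∑ y ∈ B, ∑ x ∈ B, Q (x, y) := by
  have hBB : HasSum (fun p : S × S => if p ∈ B ×ˢ B then Q p else 0)
      (∑ p ∈ B ×ˢ B, Q p) := by
    rw [← Finset.sum_congr rfl fun p (hp : p ∈ B ×ˢ B) => if_pos hp]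
    exact hasSum_sum_of_ne_finset_zero fun p hp => if_neg hp
  rw [← Finset.sum_product_right]
  refine (((hQ.2.sub (hQ.hasSum_rows B)).sub (hQ.hasSum_cols B)).add hBB).nonneg fun p => ?_
  have hp := (hQ.1 p).1
  by_cases h₁ : p.1 ∈ B <;> by_cases h₂ : p.2 ∈ B <;> simp [h₁, h₂, hp]

variable {Λ : Finset S} {x₀ : S}

lemma QLam_of_ne {x y : S} (hx : x ∈ Λ) (hy : y ∈ Λ) (hx₀ : x ≠ x₀) (hy₀ : y ≠ x₀) :
    QLam Q Λ x₀ (x, y) = Q (x, y) := by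
  simp [QLam, QLamOff, hx, hy, hx₀, hy₀]

lemma QLam_corner_right (h₀ : x₀ ∈ Λ) {x : S} (hx : x ∈ Λ) (hx₀ : x ≠ x₀) :
    QLam Q Λ x₀ (x, x₀) = margin1 Q x - ∑ z ∈ Λ.erase x₀, Q (x, z) := by
  simp [QLam, QLamOff, hx, h₀, hx₀]

lemma QLam_corner_left (h₀ : x₀ ∈ Λ) {y : S} (hy : y ∈ Λ) (hy₀ : y ≠ x₀) :
    QLam Q Λ x₀ (x₀, y) = margin1 Q y - ∑ z ∈ Λ.erase x₀, Q (z, y) := by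
  simp [QLam, QLamOff, hy, h₀, hy₀]

lemma sum_QLam (h₀ : x₀ ∈ Λ) : ∑ p ∈ Λ ×ˢ Λ, QLam Q Λ x₀ p = 1 := by
  have hcorner : QLam Q Λ x₀ (x₀, x₀) =
      1 - ∑ q ∈ (Λ ×ˢ Λ).erase (x₀, x₀), QLamOff Q Λ x₀ q := by
    simp [QLam, h₀]
  have hoff : ∑ q ∈ (Λ ×ˢ Λ).erase (x₀, x₀), QLam Q Λ x₀ q =
      ∑ q ∈ (Λ ×ˢ Λ).erase (x₀, x₀), QLamOff Q Λ x₀ q := by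
    refine Finset.sum_congr rfl fun q hq => ?_
    rw [Finset.mem_erase, Finset.mem_product] at hq
    rw [QLam, if_pos hq.2, if_neg hq.1]
  rw [← Finset.add_sum_erase _ _ (Finset.mk_mem_product h₀ h₀), hcorner, hoff, sub_add_cancel]

lemma sum_QLam_row (h₀ : x₀ ∈ Λ) {x : S} (hx : x ∈ Λ) (hx₀ : x ≠ x₀) :
    ∑ y ∈ Λ, QLam Q Λ x₀ (x, y) = margin1 Q x := by
  rw [← Finset.add_sum_erase _ _ h₀, QLam_corner_right h₀ hx hx₀,
    Finset.sum_congr rfl fun y hy =>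
      QLam_of_ne hx (Finset.mem_of_mem_erase hy) hx₀ (Finset.ne_of_mem_erase hy),
    sub_add_cancel]

lemma sum_QLam_col (h₀ : x₀ ∈ Λ) {y : S} (hy : y ∈ Λ) (hy₀ : y ≠ x₀) :
    ∑ x ∈ Λ, QLam Q Λ x₀ (x, y) = margin1 Q y := by
  rw [← Finset.add_sum_erase _ _ h₀, QLam_corner_left h₀ hy hy₀,
    Finset.sum_congr rfl fun x hx =>
      QLam_of_ne (Finset.mem_of_mem_erase hx) hy (Finset.ne_of_mem_erase hx) hy₀,
    sub_add_cancel]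

lemma sum_QLam_row_corner (h₀ : x₀ ∈ Λ) :
    ∑ y ∈ Λ, QLam Q Λ x₀ (x₀, y) = 1 - ∑ x ∈ Λ.erase x₀, margin1 Q x := by
  rw [eq_sub_iff_add_eq, ← sum_QLam (Q := Q) h₀, Finset.sum_product,
    ← Finset.sum_congr rfl fun x hx =>
      sum_QLam_row h₀ (Finset.mem_of_mem_erase hx) (Finset.ne_of_mem_erase hx)]
  exact Finset.add_sum_erase _ (fun x => ∑ y ∈ Λ, QLam Q Λ x₀ (x, y)) h₀

lemma sum_QLam_col_corner (h₀ : x₀ ∈ Λ) :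
    ∑ x ∈ Λ, QLam Q Λ x₀ (x, x₀) = 1 - ∑ y ∈ Λ.erase x₀, margin1 Q y := by
  rw [eq_sub_iff_add_eq, ← sum_QLam (Q := Q) h₀, Finset.sum_product_right,
    ← Finset.sum_congr rfl fun y hy =>
      sum_QLam_col h₀ (Finset.mem_of_mem_erase hy) (Finset.ne_of_mem_erase hy)]
  exact Finset.add_sum_erase _ (fun y => ∑ x ∈ Λ, QLam Q Λ x₀ (x, y)) h₀

lemma QLam_corner_nonneg (hQ : IsPairPM Q) (hQm : EqMarg Q) (h₀ : x₀ ∈ Λ) :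
    0 ≤ QLam Q Λ x₀ (x₀, x₀) := by
  have hrow := sum_QLam_row_corner (Q := Q) h₀
  rw [← Finset.add_sum_erase _ _ h₀, Finset.sum_congr rfl fun y hy =>
    QLam_corner_left h₀ (Finset.mem_of_mem_erase hy) (Finset.ne_of_mem_erase hy),
    Finset.sum_sub_distrib] at hrow
  have hmass := hQ.mass_compl_nonneg (Λ.erase x₀)
  rw [← show margin1 Q = margin2 Q from hQm] at hmass
  linarith

lemma QLam_nonneg (hQ : IsPairPM Q) (hQm : EqMarg Q) (h₀ : x₀ ∈ Λ) {x y : S}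
    (hx : x ∈ Λ) (hy : y ∈ Λ) : 0 ≤ QLam Q Λ x₀ (x, y) := by
  by_cases hx₀ : x = x₀ <;> by_cases hy₀ : y = x₀
  · subst hx₀ hy₀
    exact QLam_corner_nonneg hQ hQm h₀
  · rw [hx₀, QLam_corner_left h₀ hy hy₀, sub_nonneg, show margin1 Q = margin2 Q from hQm]
    exact (hQ.summable_col y).sum_le_tsum _ fun z _ => (hQ.1 (z, y)).1
  · rw [hy₀, QLam_corner_right h₀ hx hx₀, sub_nonneg]
    exact (hQ.summable_row x).sum_le_tsum _ fun z _ => (hQ.1 (x, z)).1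
  · rw [QLam_of_ne hx hy hx₀ hy₀]
    exact (hQ.1 _).1

end PairMeasure

/-- `Q_Λ` is a pair probability measure on `Λ×Λ` with equal marginals. -/
theorem stmt1 (d : ℕ) (hd : 1 ≤ d)
    (Q : ((Fin d → ℤ) × (Fin d → ℤ)) → ℝ)
    (hQ : IsPairPM Q) (hQm : EqMarg Q)
    (Λ : Finset (Fin d → ℤ)) (hΛ : Λ.Nonempty)
    (x₀ : Fin d → ℤ) (hx₀ : x₀ ∈ Λ) :
    (∀ p ∈ Λ ×ˢ Λ, 0 ≤ QLam Q Λ x₀ p ∧ QLam Q Λ x₀ p ≤ 1) ∧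
    (∑ p ∈ Λ ×ˢ Λ, QLam Q Λ x₀ p = 1) ∧
    (∀ x ∈ Λ, ∑ y ∈ Λ, QLam Q Λ x₀ (x, y) = ∑ y ∈ Λ, QLam Q Λ x₀ (y, x)) := by
  have hnonneg : ∀ p ∈ Λ ×ˢ Λ, 0 ≤ QLam Q Λ x₀ p := fun p hp =>
    QLam_nonneg hQ hQm hx₀ (Finset.mem_product.1 hp).1 (Finset.mem_product.1 hp).2
  refine ⟨fun p hp => ⟨hnonneg p hp, ?_⟩, sum_QLam hx₀, fun x hx => ?_⟩
  · rw [← sum_QLam (Q := Q) hx₀]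
    exact Finset.single_le_sum hnonneg hp
  · rcases eq_or_ne x x₀ with rfl | hne
    · rw [sum_QLam_row_corner hx₀, sum_QLam_col_corner hx₀]
    · rw [sum_QLam_row hx₀ hx hne, sum_QLam_col hx₀ hx hne]
end

section
/- Let Λ be a finite nonempty set, let N ∈ ℕ with N ≥ 1, and let Q be a pair probability measure on Λ×Λ with equal marginals such that there exists x₀ ∈ Λ with Q(x₀,x₀) ≥ (|Λ|−1)²/N. Then there exists a pair probability measure Q' on Λ×Λ with equal marginals such that N·Q'(x,y) ∈ ℕ₀ for every x,y ∈ Λ and ∑_{x,y∈Λ} |Q'(x,y) − Q(x,y)| ≤ 4|Λ|²/N. -/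
open scoped BigOperators

/-- A nonnegative real circulation of integer mass `N` on the complete digraph with loops, with
enough mass on the loop at `x₀`, is close to a nonnegative integer circulation of the same mass:
round down everywhere, repair each vertex through `x₀`, and repair the mass on the loop. -/
theorem exists_integer_circulation {α : Type*} [Fintype α] [DecidableEq α]
    (N : ℤ) (q : α → α → ℝ) (hq : ∀ x y, 0 ≤ q x y)
    (hsum : ∑ x, ∑ y, q x y = N) (hmarg : ∀ x, ∑ y, q x y = ∑ y, q y x)
    (x₀ : α) (hx₀ : ((Fintype.card α : ℝ) - 1) ^ 2 ≤ q x₀ x₀) :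
    ∃ K : α → α → ℤ, (∀ x y, 0 ≤ K x y) ∧ (∑ x, ∑ y, K x y = N) ∧
      (∀ x, ∑ y, K x y = ∑ y, K y x) ∧
      ∑ x, ∑ y, |(K x y : ℝ) - q x y| ≤ 4 * (Fintype.card α : ℝ) ^ 2 := by
  set n : ℝ := (Fintype.card α : ℝ) with hn
  have hn1 : 1 ≤ n := by
    have : 0 < Fintype.card α := Fintype.card_pos_iff.mpr ⟨x₀⟩
    rw [hn]
    exact_mod_cast this
  let F : α → α → ℤ := fun x y => if x = x₀ ∧ y = x₀ then 0 else ⌊q x y⌋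
  have hF0 : ∀ x y, 0 ≤ F x y := by
    intro x y
    simp only [F]
    split_ifs
    · exact le_rfl
    · exact Int.floor_nonneg.mpr (hq x y)
  have hFle : ∀ x y, (F x y : ℝ) ≤ q x y - if x = x₀ ∧ y = x₀ then q x₀ x₀ else 0 := by
    intro x y
    simp only [F]
    split_ifs with h
    · rw [h.1, h.2]; simp
    · simpa using Int.floor_le (q x y)
  have hFge : ∀ x y, ¬(x = x₀ ∧ y = x₀) → q x y - 1 ≤ (F x y : ℝ) := by
    intro x y h
    simp only [F, if_neg h]
    exact (Int.sub_one_lt_floor _).le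
  have hFsum : ∑ x, ∑ y, (F x y : ℝ) ≤ N - q x₀ x₀ := by
    refine (Finset.sum_le_sum fun x _ => Finset.sum_le_sum fun y _ => hFle x y).trans ?_
    simp [Finset.sum_sub_distrib, hsum, ite_and]
  let e : α → ℤ := fun x => ∑ y, F y x - ∑ y, F x y
  have hesum : ∑ x, e x = 0 := by
    simp only [e, Finset.sum_sub_distrib]
    rw [Finset.sum_comm, sub_self]
  have hebound : ∀ x, x ≠ x₀ → |(e x : ℝ)| ≤ n - 1 := by
    intro x hx
    have h1 : (e x : ℝ) = ∑ y, (((F y x : ℝ) - q y x) - ((F x y : ℝ) - q x y)) := by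
      simp only [e, Finset.sum_sub_distrib, hmarg x]
      push_cast
      ring
    rw [h1]
    refine (Finset.abs_sum_le_sum_abs _ _).trans ?_
    have h2 : ∀ y ∈ Finset.univ, |((F y x : ℝ) - q y x) - ((F x y : ℝ) - q x y)|
        ≤ 1 - if y = x then 1 else 0 := by
      intro y _
      split_ifs with h
      · simp [h]
      · have a1 := hFle x y
        have a2 := hFle y x
        have a3 := hFge x y (fun h => hx h.1)
        have a4 := hFge y x (fun h => hx h.2)
        simp only [hx, false_and, and_false, if_false] at a1 a2
        rw [abs_le]
        constructor <;> linarith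
    refine (Finset.sum_le_sum h2).trans ?_
    simp [Finset.sum_sub_distrib, hn]
  let a : α → ℤ := fun x => if x = x₀ then 0 else max (e x) 0
  let b : α → ℤ := fun x => if x = x₀ then 0 else max (-e x) 0
  have ha0 : ∀ x, 0 ≤ a x := by intro x; simp only [a]; split_ifs <;> simp
  have hb0 : ∀ x, 0 ≤ b x := by intro x; simp only [b]; split_ifs <;> simp
  have hab : ∀ x, a x - b x = e x - if x = x₀ then e x₀ else 0 := by
    intro x
    simp only [a, b]
    split_ifs with h
    · simp [h]
    · omega
  have habsum : ∑ x, a x - ∑ x, b x = -e x₀ := by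
    rw [← Finset.sum_sub_distrib, Finset.sum_congr rfl fun x _ => hab x]
    simp [Finset.sum_sub_distrib, hesum]
  have habbound : ∑ x, (a x : ℝ) + ∑ x, (b x : ℝ) ≤ (n - 1) ^ 2 := by
    rw [← Finset.sum_add_distrib]
    have h : ∀ x ∈ Finset.univ, (a x : ℝ) + b x ≤ (n - 1) - if x = x₀ then n - 1 else 0 := by
      intro x _
      by_cases hx : x = x₀
      · simp [a, b, hx]
      · have h1 : a x + b x = |e x| := by
          simp only [a, b, if_neg hx]
          rw [abs_eq_max_neg]
          omega
        have h2 : (a x : ℝ) + b x = |(e x : ℝ)| := by exact_mod_cast h1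
        rw [h2, if_neg hx, sub_zero]
        exact hebound x hx
    refine (Finset.sum_le_sum h).trans (le_of_eq ?_)
    simp [Finset.sum_sub_distrib, ← hn]
    ring
  let M : ℤ := N - ∑ x, ∑ y, F x y - ∑ x, a x - ∑ x, b x
  have hMq : q x₀ x₀ - (n - 1) ^ 2 ≤ (M : ℝ) := by
    simp only [M]
    push_cast
    linarith
  have hM0 : 0 ≤ M := by
    have : (0 : ℝ) ≤ M := by linarith
    exact_mod_cast this
  let K : α → α → ℤ := fun x y => F x y + (if y = x₀ then a x else 0) +
    (if x = x₀ then b y else 0) + if x = x₀ then (if y = x₀ then M else 0) else 0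
  have hKF : ∀ x y, F x y ≤ K x y := by
    intro x y
    have := ha0 x
    have := hb0 y
    simp only [K]
    split_ifs <;> omega
  have hrow : ∀ x, ∑ y, K x y = ∑ y, F x y + a x + if x = x₀ then ∑ y, b y + M else 0 := by
    intro x
    simp only [K, Finset.sum_add_distrib]
    by_cases h : x = x₀ <;> simp [h, add_assoc]
  have hcol : ∀ x, ∑ y, K y x = ∑ y, F y x + b x + if x = x₀ then ∑ y, a y + M else 0 := by
    intro x
    simp only [K, Finset.sum_add_distrib]
    by_cases h : x = x₀
    · simp [h]; ring
    · simp [h]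
  have hKsum : ∑ x, ∑ y, K x y = N := by
    simp only [hrow, Finset.sum_add_distrib, Finset.sum_ite_eq', Finset.mem_univ, if_true, M]
    ring
  refine ⟨K, fun x y => (hF0 x y).trans (hKF x y), hKsum, ?_, ?_⟩
  · intro x
    rw [hrow, hcol]
    have h := hab x
    have he : e x = ∑ y, F y x - ∑ y, F x y := rfl
    split_ifs at h ⊢ with hx
    · subst hx
      linarith
    · linarith
  · have hpt : ∀ x y, |(K x y : ℝ) - q x y| ≤ ((K x y : ℝ) - q x y) +
        2 * (1 + if x = x₀ then (if y = x₀ then (n - 1) ^ 2 else 0) else 0) := by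
      intro x y
      have hc : q x y - K x y ≤
          1 + if x = x₀ then (if y = x₀ then (n - 1) ^ 2 else 0) else 0 := by
        by_cases h : x = x₀ ∧ y = x₀
        · obtain ⟨rfl, rfl⟩ := h
          have : (M : ℝ) ≤ K y y := by
            have h1 : M ≤ K y y := by simp [K, F, a, b]
            exact_mod_cast h1
          simp only [if_true]
          linarith
        · have h1 := hFge x y h
          have h2 : (F x y : ℝ) ≤ K x y := by exact_mod_cast hKF x y
          rw [← ite_and, if_neg h]
          linarith
      have hc0 : (0 : ℝ) ≤ 1 + if x = x₀ then (if y = x₀ then (n - 1) ^ 2 else 0) else 0 := by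
        split_ifs <;> positivity
      rw [abs_le]
      constructor <;> linarith
    refine (Finset.sum_le_sum fun x _ => Finset.sum_le_sum fun y _ => hpt x y).trans ?_
    have hKsum' : ∑ x, ∑ y, (K x y : ℝ) = N := by exact_mod_cast hKsum
    have hconst : ∑ x : α, ∑ y : α,
        (1 + if x = x₀ then (if y = x₀ then (n - 1) ^ 2 else 0) else 0) = n ^ 2 + (n - 1) ^ 2 := by
      simp only [Finset.sum_add_distrib]
      congr 1
      · simp [← hn, sq]
      · rw [Finset.sum_eq_single x₀] <;> simp +contextual
    simp only [Finset.sum_add_distrib, Finset.sum_sub_distrib, ← Finset.mul_sum] at hconst ⊢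
    rw [hKsum', hsum]
    nlinarith

/-- discretisation of a pair probability measure with equal marginals on a
finite set: there is an `(1/N)·ℕ₀`-valued pair probability measure with equal marginals
at L¹-distance at most `4|Λ|²/N`. -/
theorem stmt5 (α : Type) [Fintype α] [DecidableEq α] [Nonempty α]
    (N : ℕ) (hN : 1 ≤ N)
    (Q : α × α → ℝ)
    (hQ01 : ∀ p, 0 ≤ Q p ∧ Q p ≤ 1)
    (hQsum : ∑ p : α × α, Q p = 1)
    (hQmarg : ∀ x : α, ∑ y : α, Q (x, y) = ∑ y : α, Q (y, x))
    (hcorner : ∃ x₀ : α, ((Fintype.card α : ℝ) - 1) ^ 2 / (N : ℝ) ≤ Q (x₀, x₀)) :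
    ∃ Q' : α × α → ℝ,
      (∀ p, 0 ≤ Q' p ∧ Q' p ≤ 1) ∧
      (∑ p : α × α, Q' p = 1) ∧
      (∀ x : α, ∑ y : α, Q' (x, y) = ∑ y : α, Q' (y, x)) ∧
      (∀ p, ∃ k : ℕ, (N : ℝ) * Q' p = (k : ℝ)) ∧
      ∑ p : α × α, |Q' p - Q p| ≤ 4 * (Fintype.card α : ℝ) ^ 2 / (N : ℝ) := by
  obtain ⟨x₀, hx₀⟩ := hcorner
  have hN0 : (0 : ℝ) < N := by exact_mod_cast hN
  rw [Fintype.sum_prod_type] at hQsum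
  obtain ⟨K, hK0, hKsum, hKmarg, hKdist⟩ := exists_integer_circulation (N : ℤ)
    (fun x y => (N : ℝ) * Q (x, y)) (fun x y => mul_nonneg hN0.le (hQ01 _).1)
    (by simp [← Finset.mul_sum, hQsum])
    (fun x => by simp only [← Finset.mul_sum, hQmarg x]) x₀
    (by rwa [div_le_iff₀' hN0] at hx₀)
  have hnonneg : ∀ p : α × α, 0 ≤ (K p.1 p.2 : ℝ) / N := fun p =>
    div_nonneg (by exact_mod_cast hK0 _ _) hN0.le
  have hsum : ∑ p : α × α, (K p.1 p.2 : ℝ) / N = 1 := by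
    rw [← Finset.sum_div, Fintype.sum_prod_type, div_eq_one_iff_eq hN0.ne']
    exact_mod_cast hKsum
  refine ⟨fun p => (K p.1 p.2 : ℝ) / N, fun p => ⟨hnonneg p, ?_⟩, hsum, ?_, ?_, ?_⟩
  · rw [← hsum]
    exact Finset.single_le_sum (f := fun p : α × α => (K p.1 p.2 : ℝ) / N)
      (fun p _ => hnonneg p) (Finset.mem_univ p)
  · intro x
    simp only [← Finset.sum_div]
    congr 1
    exact_mod_cast hKmarg x
  · intro p
    refine ⟨(K p.1 p.2).toNat, ?_⟩
    rw [mul_div_cancel₀ _ hN0.ne']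
    exact_mod_cast (Int.toNat_of_nonneg (hK0 p.1 p.2)).symm
  · rw [le_div_iff₀ hN0, Finset.sum_mul, Fintype.sum_prod_type]
    refine le_trans (le_of_eq ?_) hKdist
    refine Finset.sum_congr rfl fun x _ => Finset.sum_congr rfl fun y _ => ?_
    rw [← abs_of_pos hN0, ← abs_mul, abs_of_pos hN0, sub_mul, div_mul_cancel₀ _ hN0.ne',
      mul_comm (Q (x, y))]
end

section
/- Let Λ be a finite nonempty set, N ∈ ℕ with N ≥ 1, and let K : Λ×Λ → ℕ₀ satisfy ∑_{a,b∈Λ} K(a,b) = N and have equal marginals, i.e. k(a) := ∑_{b∈Λ} K(a,b) = ∑_{b∈Λ} K(b,a) for every a ∈ Λ. Then ∑_{x̄∈Λ^N} #{σ ∈ Sym_N : for all a,b ∈ Λ, #{i ∈ {1,…,N} : x_i = a and x_{σ(i)} = b} = K(a,b)} = N! · ∏_{a∈Λ} k(a)! / ∏_{a,b∈Λ} K(a,b)!. -/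
open scoped BigOperators

open Finset

/-- Two functions with equinumerous fibers differ by a permutation of their domain. -/
lemma exists_perm_comp_eq {ι β : Type*} [Fintype ι] [DecidableEq β] (f g : ι → β)
    (h : ∀ b, #{i | f i = b} = #{i | g i = b}) :
    ∃ e : Equiv.Perm ι, ∀ i, f (e i) = g i := by
  have hfib : ∀ b, Nonempty ({i // g i = b} ≃ {i // f i = b}) := fun b =>
    ⟨Fintype.equivOfCardEq (by simp only [Fintype.card_subtype, h])⟩
  exact ⟨Equiv.ofFiberEquiv fun b => (hfib b).some, Equiv.ofFiberEquiv_map _⟩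

/-- If `f` and `g` have fibers of the same sizes `k b`, then exactly `∏ b, (k b)!` permutations
carry `f` to `g`. -/
lemma card_perm_comp_eq {ι β : Type*} [Fintype ι] [DecidableEq ι] [Fintype β] [DecidableEq β]
    (f g : ι → β) (k : β → ℕ) (hf : ∀ b, #{i | f i = b} = k b)
    (hg : ∀ b, #{i | g i = b} = k b) :
    #{σ : Equiv.Perm ι | ∀ i, f (σ i) = g i} = ∏ b, (k b).factorial := by
  obtain ⟨e, he⟩ := exists_perm_comp_eq f g fun b => (hf b).trans (hg b).symm
  have hstab := DomMulAct.stabilizer_card f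
  simp only [Fintype.card_subtype, hf] at hstab
  rw [← hstab]
  refine card_nbij' (· * e⁻¹) (· * e) ?_ ?_ ?_ ?_
  · intro σ hσ
    simp only [coe_filter, mem_univ, true_and, Set.mem_ofPred_eq] at hσ ⊢
    funext i
    simp [hσ, ← he]
  · intro σ hσ
    simp only [coe_filter, mem_univ, true_and, Set.mem_ofPred_eq] at hσ ⊢
    intro i
    simpa [he] using congrFun hσ (e i)
  · intro σ _; simp
  · intro σ _; simp

lemma exists_fun_card_fiber_eq {β : Type*} [Fintype β] [DecidableEq β] {N : ℕ} (K : β → ℕ)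
    (hK : ∑ b, K b = N) : ∃ z : Fin N → β, ∀ b, #{i | z i = b} = K b := by
  have e : Fin N ≃ Σ b, Fin (K b) := Fintype.equivOfCardEq (by simp [hK])
  refine ⟨fun i => (e i).1, fun b => ?_⟩
  have hfib : {i // (e i).1 = b} ≃ Fin (K b) :=
    (e.subtypeEquiv fun _ => Iff.rfl).trans (Equiv.sigmaSubtype b)
  rw [← Fintype.card_subtype, Fintype.card_congr hfib, Fintype.card_fin]

/-- The multinomial count of words with prescribed letter frequencies. -/
lemma card_fun_card_fiber_eq_mul {β : Type*} [Fintype β] [DecidableEq β] {N : ℕ} (K : β → ℕ)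
    (hK : ∑ b, K b = N) :
    #{z : Fin N → β | ∀ b, #{i | z i = b} = K b} * ∏ b, (K b).factorial = N.factorial := by
  obtain ⟨w, hw⟩ := exists_fun_card_fiber_eq K hK
  have hmaps : ∀ σ ∈ (univ : Finset (Equiv.Perm (Fin N))),
      w ∘ σ ∈ ({z | ∀ b, #{i | z i = b} = K b} : Finset (Fin N → β)) := by
    intro σ _
    simp only [mem_filter, mem_univ, true_and]
    intro b
    rw [← hw b]
    exact card_equiv σ (by simp)
  have hcount := card_eq_sum_card_fiberwise hmaps
  rw [card_univ, Fintype.card_perm, Fintype.card_fin] at hcount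
  rw [hcount, ← smul_eq_mul, ← sum_const]
  refine sum_congr rfl fun z hz => ?_
  rw [← card_perm_comp_eq w z K hw (by simpa using hz)]
  congr 1
  ext σ
  simp [funext_iff]

lemma card_fiber_fst {ι α β : Type*} [Fintype ι] [Fintype β] [DecidableEq α] [DecidableEq β]
    (z : ι → α × β) (a : α) : #{i | (z i).1 = a} = ∑ b, #{i | z i = (a, b)} := by
  rw [card_eq_sum_card_fiberwise (f := fun i => (z i).2) (t := univ) (by simp)]
  simp only [filter_filter, Prod.ext_iff]

lemma card_fiber_snd {ι α β : Type*} [Fintype ι] [Fintype α] [DecidableEq α] [DecidableEq β]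
    (z : ι → α × β) (b : β) : #{i | (z i).2 = b} = ∑ a, #{i | z i = (a, b)} := by
  rw [card_eq_sum_card_fiberwise (f := fun i => (z i).1) (t := univ) (by simp)]
  simp only [filter_filter, Prod.ext_iff, and_comm]

/-- Pairs of a configuration and a permutation with pair frequencies `K` correspond to words of
pairs with letter frequencies `K` together with a permutation matching first to second entries. -/
lemma sum_card_perm_pair_eq {ι α : Type*} [Fintype ι] [DecidableEq ι] [Fintype α] [DecidableEq α]
    (K : α × α → ℕ) :
    ∑ x : ι → α, #{σ : Equiv.Perm ι | ∀ a b, #{i | x i = a ∧ x (σ i) = b} = K (a, b)} =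
      ∑ z : ι → α × α with ∀ p, #{i | z i = p} = K p,
        #{σ : Equiv.Perm ι | ∀ i, (z (σ i)).1 = (z i).2} := by
  rw [← card_sigma, ← card_sigma]
  refine card_nbij' (fun y => ⟨fun i => (y.1 i, y.1 (y.2 i)), y.2⟩)
    (fun y => ⟨fun i => (y.1 i).1, y.2⟩) ?_ ?_ ?_ ?_
  · rintro ⟨x, σ⟩ h
    simpa [Prod.ext_iff] using h
  · rintro ⟨z, σ⟩ h
    simp only [coe_sigma, Set.mem_sigma_iff, mem_coe, mem_filter, mem_univ, true_and] at h ⊢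
    intro a b
    rw [← h.1 (a, b)]
    simp only [h.2, Prod.ext_iff]
  · rintro ⟨x, σ⟩ _
    rfl
  · rintro ⟨z, σ⟩ h
    simp only [coe_sigma, Set.mem_sigma_iff, mem_coe, mem_filter, mem_univ, true_and] at h
    simp only [h.2]

/-- summed over all configurations `x̄ ∈ Λ^N`, the number of permutations
realising the pair-frequency matrix `K` (with equal marginals `k`) equals
`N!·∏_a k(a)!/∏_{a,b} K(a,b)!`. -/
theorem stmt8 (α : Type) [Fintype α] [DecidableEq α] [Nonempty α]
    (N : ℕ) (hN : 1 ≤ N)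
    (K : α × α → ℕ) (hK : ∑ p : α × α, K p = N)
    (hKmarg : ∀ a : α, ∑ b : α, K (a, b) = ∑ b : α, K (b, a)) :
    ((∑ x : Fin N → α,
        (Finset.univ.filter
          (fun σ : Equiv.Perm (Fin N) => ∀ a b : α,
            (Finset.univ.filter
              (fun i : Fin N => x i = a ∧ x (σ i) = b)).card = K (a, b))).card : ℕ) : ℝ)
      = (N.factorial : ℝ) *
          (∏ a : α, ((∑ b : α, K (a, b)).factorial : ℝ)) /
            ∏ p : α × α, ((K p).factorial : ℝ) := by
  rw [eq_div_iff (by positivity)]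
  norm_cast
  rw [sum_card_perm_pair_eq, ← card_fun_card_fiber_eq_mul K hK]
  rw [sum_congr rfl (g := fun _ => ∏ a : α, (∑ b : α, K (a, b)).factorial)]
  · rw [sum_const, smul_eq_mul, mul_right_comm]
  · intro z hz
    simp only [mem_filter, mem_univ, true_and] at hz
    refine card_perm_comp_eq (fun i => (z i).1) (fun i => (z i).2) _ (fun a => ?_) fun a => ?_
    · simp only [card_fiber_fst, hz]
    · simp only [card_fiber_snd, hz, hKmarg]
end

section
/- There exists an absolute constant C > 0 such that the following holds for every finite nonempty set Λ, every N ∈ ℕ with N ≥ 2, every probability measure m on Λ with m(a) > 0 for all a ∈ Λ, and every K : Λ×Λ → ℕ₀ with ∑_{a,b∈Λ} K(a,b) = N and equal marginals k(a) := ∑_{b} K(a,b) = ∑_{b} K(b,a): with Q(a,b) := K(a,b)/N and Q⁽¹⁾(a) := k(a)/N, one has ∏_{a∈Λ} m(a)^{k(a)} · ∏_{a∈Λ} k(a)! / ∏_{a,b∈Λ} K(a,b)! ≥ exp(−C·|Λ|²·log N) · exp(−N·H(Q|Q⁽¹⁾⊗m)), where H(Q|Q⁽¹⁾⊗m) = ∑_{a,b∈Λ}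 Q(a,b)·log( Q(a,b) / (Q⁽¹⁾(a)·m(b)) ) with the convention 0·log 0 = 0. -/
open scoped BigOperators

lemma mul_log_sub_self_le_log_factorial (n : ℕ) :
    (n : ℝ) * Real.log n - n ≤ Real.log (n.factorial : ℝ) := by
  rcases Nat.eq_zero_or_pos n with rfl | hn
  · simp
  have hn' : (0 : ℝ) < n := by exact_mod_cast hn
  have hf : (0 : ℝ) < n.factorial := by exact_mod_cast n.factorial_pos
  have h := Real.log_le_log (by positivity) (Real.pow_div_factorial_le_exp (n : ℝ) hn'.le n)
  rw [Real.log_exp, Real.log_div (by positivity) hf.ne', Real.log_pow] at h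
  linarith

lemma log_factorial_le_of_pos {n : ℕ} (hn : 0 < n) :
    Real.log (n.factorial : ℝ) ≤ n * Real.log n - n + 1 + Real.log n / 2 := by
  obtain ⟨k, rfl⟩ := Nat.exists_eq_succ_of_ne_zero hn.ne'
  have h := Stirling.log_stirlingSeq'_antitone (Nat.zero_le k)
  have hk : ((k.succ : ℕ) : ℝ) ≠ 0 := by exact_mod_cast hn.ne'
  simp only [Function.comp_apply, Stirling.log_stirlingSeq_formula] at h
  rw [Real.log_div hk (Real.exp_ne_zero 1), Real.log_mul two_ne_zero hk] at h
  simp at h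
  push_cast [Nat.succ_eq_add_one] at h ⊢
  linarith

lemma log_factorial_le_of_le {n N : ℕ} (hN : 2 ≤ N) (hn : n ≤ N) :
    Real.log (n.factorial : ℝ) ≤ n * Real.log n - n + 3 * Real.log N := by
  have h2 : Real.log 2 ≤ Real.log N := Real.log_le_log (by norm_num) (by exact_mod_cast hN)
  have h2' := Real.log_two_gt_d9
  rcases Nat.eq_zero_or_pos n with rfl | hpos
  · simp
    linarith
  have hnN : Real.log n ≤ Real.log N :=
    Real.log_le_log (by exact_mod_cast hpos) (by exact_mod_cast hn)
  linarith [log_factorial_le_of_pos hpos]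

/-- The relative entropy `N * H(Q|Q⁽¹⁾⊗m)` written in terms of the counts `K`. -/
lemma mul_sum_mul_log_eq {α : Type*} [Fintype α] {N : ℕ} (hN : N ≠ 0) {m : α → ℝ}
    (hm : ∀ a, 0 < m a) (K : α × α → ℕ)
    (hK : ∀ a : α, ∑ b : α, K (a, b) = ∑ b : α, K (b, a)) :
    (N : ℝ) * ∑ p : α × α, ((K p : ℝ) / N) *
        Real.log (((K p : ℝ) / N) / (((∑ b : α, K (p.1, b) : ℕ) : ℝ) / N * m p.2)) =
      ∑ p : α × α, (K p : ℝ) * Real.log (K p) -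
        ∑ a : α, ((∑ b : α, K (a, b) : ℕ) : ℝ) * Real.log ((∑ b : α, K (a, b) : ℕ) : ℝ) -
        ∑ a : α, ((∑ b : α, K (a, b) : ℕ) : ℝ) * Real.log (m a) := by
  have hN' : (N : ℝ) ≠ 0 := by exact_mod_cast hN
  have hrow : ∑ a : α, ((∑ b : α, K (a, b) : ℕ) : ℝ) *
        Real.log ((∑ b : α, K (a, b) : ℕ) : ℝ) =
      ∑ p : α × α, (K p : ℝ) * Real.log ((∑ b : α, K (p.1, b) : ℕ) : ℝ) := by
    rw [Fintype.sum_prod_type]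
    refine Finset.sum_congr rfl fun a _ => ?_
    dsimp only
    rw [← Finset.sum_mul, Nat.cast_sum]
  have hcol : ∑ a : α, ((∑ b : α, K (a, b) : ℕ) : ℝ) * Real.log (m a) =
      ∑ p : α × α, (K p : ℝ) * Real.log (m p.2) := by
    rw [Fintype.sum_prod_type_right]
    refine Finset.sum_congr rfl fun a _ => ?_
    dsimp only
    rw [← Finset.sum_mul, hK, Nat.cast_sum]
  rw [hrow, hcol, ← Finset.sum_sub_distrib, ← Finset.sum_sub_distrib, Finset.mul_sum]
  refine Finset.sum_congr rfl fun p _ => ?_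
  rcases Nat.eq_zero_or_pos (K p) with h0 | hpos
  · simp [h0]
  have hle : K p ≤ ∑ b : α, K (p.1, b) :=
    Finset.single_le_sum (f := fun b => K (p.1, b)) (fun _ _ => Nat.zero_le _)
      (Finset.mem_univ p.2)
  have hk : ((∑ b : α, K (p.1, b) : ℕ) : ℝ) ≠ 0 := by
    exact_mod_cast (hpos.trans_le hle).ne'
  have hp : (K p : ℝ) ≠ 0 := by exact_mod_cast hpos.ne'
  have hmp := (hm p.2).ne'
  rw [Real.log_div (div_ne_zero hp hN') (mul_ne_zero (div_ne_zero hk hN') hmp),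
    Real.log_mul (div_ne_zero hk hN') hmp, Real.log_div hp hN', Real.log_div hk hN',
    ← mul_assoc, mul_div_cancel₀ _ hN']
  ring

/-- a uniform Stirling-type lower bound of the combinatorial weight in terms
of the relative entropy `H(Q|Q⁽¹⁾⊗m)` with `Q = K/N`. -/
theorem stmt9 :
    ∃ C : ℝ, 0 < C ∧
      ∀ (α : Type) [Fintype α] [DecidableEq α], Nonempty α →
      ∀ N : ℕ, 2 ≤ N →
      ∀ m : α → ℝ, (∀ a, 0 < m a) → (∑ a : α, m a = 1) →
      ∀ K : α × α → ℕ, (∑ p : α × α, K p = N) →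
        (∀ a : α, ∑ b : α, K (a, b) = ∑ b : α, K (b, a)) →
        Real.exp (-C * (Fintype.card α : ℝ) ^ 2 * Real.log N) *
            Real.exp (-(N : ℝ) *
              ∑ p : α × α, ((K p : ℝ) / N) *
                Real.log (((K p : ℝ) / N) /
                  (((∑ b : α, K (p.1, b) : ℕ) : ℝ) / N * m p.2)))
          ≤ (∏ a : α, m a ^ (∑ b : α, K (a, b))) *
              (∏ a : α, ((∑ b : α, K (a, b)).factorial : ℝ)) /
                ∏ p : α × α, ((K p).factorial : ℝ) := by
  refine ⟨3, by norm_num, fun α _ _ _ N hN m hm _ K hKN hK => ?_⟩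
  have hm_prod : 0 < ∏ a : α, m a ^ (∑ b : α, K (a, b)) :=
    Finset.prod_pos fun a _ => pow_pos (hm a) _
  have hrow_prod : 0 < ∏ a : α, ((∑ b : α, K (a, b)).factorial : ℝ) :=
    Finset.prod_pos fun a _ => by exact_mod_cast Nat.factorial_pos _
  have hK_prod : 0 < ∏ p : α × α, ((K p).factorial : ℝ) :=
    Finset.prod_pos fun p _ => by exact_mod_cast Nat.factorial_pos _
  rw [← Real.exp_add, ← Real.le_log_iff_exp_le (by positivity),
    Real.log_div (by positivity) hK_prod.ne', Real.log_mul hm_prod.ne' hrow_prod.ne',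
    Real.log_prod fun a _ => (pow_pos (hm a) _).ne',
    Real.log_prod fun a _ => by exact_mod_cast Nat.factorial_ne_zero _,
    Real.log_prod fun p _ => by exact_mod_cast Nat.factorial_ne_zero _,
    neg_mul (N : ℝ), mul_sum_mul_log_eq (by omega) hm K hK]
  simp only [Real.log_pow]
  have hlower := Finset.sum_le_sum fun (a : α) (_ : a ∈ Finset.univ) =>
    mul_log_sub_self_le_log_factorial (∑ b : α, K (a, b))
  have hupper := Finset.sum_le_sum fun (p : α × α) (_ : p ∈ Finset.univ) =>
    log_factorial_le_of_le hN (n := K p) (hKN ▸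
      Finset.single_le_sum (f := K) (fun _ _ => Nat.zero_le _) (Finset.mem_univ p))
  have htotal : ∑ a : α, ((∑ b : α, K (a, b) : ℕ) : ℝ) = ∑ p : α × α, (K p : ℝ) := by
    simp only [Fintype.sum_prod_type, Nat.cast_sum]
  rw [Finset.sum_sub_distrib] at hlower
  rw [Finset.sum_add_distrib, Finset.sum_sub_distrib, Finset.sum_const, Finset.card_univ,
    Fintype.card_prod, nsmul_eq_mul, Nat.cast_mul] at hupper
  linarith
end

section
/- Let d ≥ 1 and let Λ ⊂ ℤ^d be a finite nonempty set. For f : Λ → ℝ define the principal eigenvalue λ_Λ(f) = sup{ ∑_{x∈Λ} f(x)·g(x)² − E(g) : g : ℤ^d → ℝ, supp(g) ⊆ Λ, ∑_{x∈ℤ^d} g(x)² = 1 }, where E(g) = (1/2)·∑_{x,y∈ℤ^d, |x−y|=1}(g(x)−g(y))². Then for every probability measure p on ℤ^d with supp(p) ⊆ Λ, the Legendre–Fenchel transform of λ_Λ at p equals the Dirichlet form of √p: sup_{f : Λ → ℝ} ( ∑_{x∈Λ} f(x)·p(x) − λ_Λ(f) ) = E(√p), where √p denotes the function x ↦ √(p(x)).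 -/
open scoped BigOperators

/-- Lattice (sup) distance on `ℤ^d`: `max_i |x_i − y_i|`. -/
def latDist {d : ℕ} (x y : Fin d → ℤ) : ℕ :=
  Finset.univ.sup fun i : Fin d => (x i - y i).natAbs

/-- Dirichlet form `E(g) = (1/2)·∑_{|x−y|=1} (g(x)−g(y))²` on `ℤ^d`. -/
noncomputable def dirichlet {d : ℕ} (g : (Fin d → ℤ) → ℝ) : ℝ :=
  (1 / 2) * ∑' p : (Fin d → ℤ) × (Fin d → ℤ),
    if latDist p.1 p.2 = 1 then (g p.1 - g p.2) ^ 2 else 0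

/-- Principal eigenvalue `λ_Λ(f)` of `Δ_Λ + f` with zero boundary conditions,
via the Rayleigh–Ritz variational formula. -/
noncomputable def lamLam {d : ℕ} (Λ : Finset (Fin d → ℤ)) (f : (Fin d → ℤ) → ℝ) : ℝ :=
  sSup {r : ℝ | ∃ g : (Fin d → ℤ) → ℝ,
      Function.support g ⊆ ↑Λ ∧ (∑' x, g x ^ 2) = 1 ∧
      r = ∑ x ∈ Λ, f x * g x ^ 2 - dirichlet g}

open Filter Topology

/-- A finite box-neighbourhood of `Λ`, containing `Λ` and every lattice neighbour of it. -/
noncomputable def latNbhd {d : ℕ} (Λ : Finset (Fin d → ℤ)) : Finset (Fin d → ℤ) :=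
  Λ.biUnion fun x => Finset.Icc (x - 1) (x + 1)

/-- The adjacency weight of the lattice: `1` for neighbours and `0` otherwise. -/
noncomputable def latAdj {d : ℕ} (x y : Fin d → ℤ) : ℝ :=
  if latDist x y = 1 then 1 else 0

lemma latDist_comm {d : ℕ} (x y : Fin d → ℤ) : latDist x y = latDist y x := by
  unfold latDist
  congr 1
  funext i
  omega

lemma latAdj_comm {d : ℕ} (x y : Fin d → ℤ) : latAdj x y = latAdj y x := by
  rw [latAdj, latAdj, latDist_comm]

lemma latAdj_nonneg {d : ℕ} (x y : Fin d → ℤ) : 0 ≤ latAdj x y := by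
  unfold latAdj
  split_ifs <;> norm_num

lemma subset_latNbhd {d : ℕ} (Λ : Finset (Fin d → ℤ)) : Λ ⊆ latNbhd Λ := fun x hx =>
  Finset.mem_biUnion.2 ⟨x, hx, Finset.mem_Icc.2 ⟨fun i => by simp, fun i => by simp⟩⟩

lemma mem_latNbhd_of_latDist_eq_one {d : ℕ} {Λ : Finset (Fin d → ℤ)} {x y : Fin d → ℤ}
    (hx : x ∈ Λ) (h : latDist x y = 1) : y ∈ latNbhd Λ := by
  have hi : ∀ i, (x i - y i).natAbs ≤ 1 := fun i =>
    h ▸ Finset.le_sup (f := fun i : Fin d => (x i - y i).natAbs) (Finset.mem_univ i)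
  refine Finset.mem_biUnion.2 ⟨x, hx, Finset.mem_Icc.2 ⟨fun i => ?_, fun i => ?_⟩⟩
  · have := hi i
    simp only [Pi.sub_apply, Pi.one_apply]
    omega
  · have := hi i
    simp only [Pi.add_apply, Pi.one_apply]
    omega

lemma dirichlet_nonneg {d : ℕ} (g : (Fin d → ℤ) → ℝ) : 0 ≤ dirichlet g := by
  refine mul_nonneg (by norm_num) (tsum_nonneg fun q => ?_)
  split_ifs <;> positivity

/-- For functions supported in `Λ` the Dirichlet form is a finite sum. -/
lemma dirichlet_eq_sum {d : ℕ} {Λ : Finset (Fin d → ℤ)} {g : (Fin d → ℤ) → ℝ}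
    (hg : ∀ x, x ∉ Λ → g x = 0) :
    dirichlet g = (1 / 2) * ∑ x ∈ latNbhd Λ, ∑ y ∈ latNbhd Λ, latAdj x y * (g x - g y) ^ 2 := by
  rw [dirichlet, ← Finset.sum_product', tsum_eq_sum (s := latNbhd Λ ×ˢ latNbhd Λ)]
  · congr 1
    refine Finset.sum_congr rfl fun q _ => ?_
    simp [latAdj]
  · rintro ⟨x, y⟩ hxy
    simp only [Finset.mem_product] at hxy
    split_ifs with h
    · have hx : x ∉ Λ := fun hx =>
        hxy ⟨subset_latNbhd Λ hx, mem_latNbhd_of_latDist_eq_one hx h⟩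
      have hy : y ∉ Λ := fun hy =>
        hxy ⟨mem_latNbhd_of_latDist_eq_one hy (latDist_comm x y ▸ h), subset_latNbhd Λ hy⟩
      simp [hg x hx, hg y hy]
    · rfl

/-- Symmetrization of a double sum against a symmetric weight. -/
lemma sum_latAdj_mul_eq_half_symm {d : ℕ} (B : Finset (Fin d → ℤ))
    (F : (Fin d → ℤ) → (Fin d → ℤ) → ℝ) :
    ∑ x ∈ B, ∑ y ∈ B, latAdj x y * F x y =
      (1 / 2) * ∑ x ∈ B, ∑ y ∈ B, latAdj x y * (F x y + F y x) := by
  have h : ∑ x ∈ B, ∑ y ∈ B, latAdj x y * F x y = ∑ x ∈ B, ∑ y ∈ B, latAdj x y * F y x := by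
    rw [Finset.sum_comm]
    exact Finset.sum_congr rfl fun x _ => Finset.sum_congr rfl fun y _ => by
      rw [latAdj_comm]
  simp only [mul_add, Finset.sum_add_distrib]
  linarith

/-- Summation by parts for the Dirichlet form. -/
lemma dirichlet_eq_sum_mul {d : ℕ} {Λ : Finset (Fin d → ℤ)} {g : (Fin d → ℤ) → ℝ}
    (hg : ∀ x, x ∉ Λ → g x = 0) :
    dirichlet g = ∑ x ∈ latNbhd Λ, ∑ y ∈ latNbhd Λ, latAdj x y * ((g x - g y) * g x) := by
  rw [dirichlet_eq_sum hg,
    sum_latAdj_mul_eq_half_symm (latNbhd Λ) fun x y => (g x - g y) * g x]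
  congr 1
  exact Finset.sum_congr rfl fun x _ => Finset.sum_congr rfl fun y _ => by ring

/-- The potential `-Δh / h` on `Λ`. -/
noncomputable def groundPotential {d : ℕ} (Λ : Finset (Fin d → ℤ)) (h : (Fin d → ℤ) → ℝ)
    (x : Fin d → ℤ) : ℝ :=
  ∑ y ∈ latNbhd Λ, latAdj x y * ((h x - h y) / h x)

lemma sum_groundPotential_mul {d : ℕ} {Λ : Finset (Fin d → ℤ)} (h : (Fin d → ℤ) → ℝ)
    {q : (Fin d → ℤ) → ℝ} (hq : ∀ x, x ∉ Λ → q x = 0) :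
    ∑ x ∈ Λ, groundPotential Λ h x * q x =
      ∑ x ∈ latNbhd Λ, ∑ y ∈ latNbhd Λ, latAdj x y * ((h x - h y) * (q x / h x)) := by
  rw [Finset.sum_subset (subset_latNbhd Λ) fun x _ hx => by rw [hq x hx, mul_zero]]
  refine Finset.sum_congr rfl fun x _ => ?_
  rw [groundPotential, Finset.sum_mul]
  exact Finset.sum_congr rfl fun y _ => by ring

/-- The pointwise inequality behind the ground state representation. -/
lemma ground_state_pointwise {a b u v : ℝ} (ha : 0 ≤ a) (hb : 0 ≤ b)
    (hau : a = 0 → u = 0) (hbv : b = 0 → v = 0) :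
    (a - b) * (u ^ 2 / a) + (b - a) * (v ^ 2 / b) ≤ (u - v) ^ 2 := by
  rcases ha.eq_or_lt with rfl | ha
  · rcases hb.eq_or_lt with rfl | hb
    · simp [hau rfl, hbv rfl]
    · have : b * (v ^ 2 / b) = v ^ 2 := by field_simp
      simp [hau rfl, this]
  · rcases hb.eq_or_lt with rfl | hb
    · have : a * (u ^ 2 / a) = u ^ 2 := by field_simp
      simp [hbv rfl, this]
    · have : (u - v) ^ 2 - ((a - b) * (u ^ 2 / a) + (b - a) * (v ^ 2 / b)) =
          a * b * (u / a - v / b) ^ 2 := by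
        field_simp
        ring
      have : 0 ≤ a * b * (u / a - v / b) ^ 2 := by positivity
      linarith

lemma sum_groundPotential_mul_sq_le_dirichlet {d : ℕ} {Λ : Finset (Fin d → ℤ)}
    {h g : (Fin d → ℤ) → ℝ} (hpos : ∀ x ∈ Λ, 0 < h x) (hzero : ∀ x, x ∉ Λ → h x = 0)
    (hg : ∀ x, x ∉ Λ → g x = 0) :
    ∑ x ∈ Λ, groundPotential Λ h x * g x ^ 2 ≤ dirichlet g := by
  have hnn : ∀ x, 0 ≤ h x := fun x => by
    by_cases hx : x ∈ Λ
    · exact (hpos x hx).le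
    · exact (hzero x hx).ge
  have hgz : ∀ x, h x = 0 → g x = 0 := fun x hx =>
    hg x fun hxΛ => (hpos x hxΛ).ne' hx
  rw [sum_groundPotential_mul h fun x hx => by rw [hg x hx]; norm_num,
    sum_latAdj_mul_eq_half_symm, dirichlet_eq_sum hg]
  gcongr with x _ y _
  · exact latAdj_nonneg x y
  · exact ground_state_pointwise (hnn x) (hnn y) (hgz x) (hgz y)

lemma lamLam_groundPotential_nonpos {d : ℕ} {Λ : Finset (Fin d → ℤ)}
    {h : (Fin d → ℤ) → ℝ} (hpos : ∀ x ∈ Λ, 0 < h x) (hzero : ∀ x, x ∉ Λ → h x = 0) :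
    lamLam Λ (groundPotential Λ h) ≤ 0 := by
  refine Real.sSup_le ?_ le_rfl
  rintro r ⟨g, hg, -, rfl⟩
  exact sub_nonpos.2 <| sum_groundPotential_mul_sq_le_dirichlet hpos hzero fun x hx =>
    Function.notMem_support.1 fun hx' => hx (hg hx')

/-- Each admissible test function bounds the principal eigenvalue from below. -/
lemma le_lamLam {d : ℕ} {Λ : Finset (Fin d → ℤ)} (f : (Fin d → ℤ) → ℝ)
    {g : (Fin d → ℤ) → ℝ} (hg : Function.support g ⊆ ↑Λ) (hg1 : ∑' x, g x ^ 2 = 1) :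
    ∑ x ∈ Λ, f x * g x ^ 2 - dirichlet g ≤ lamLam Λ f := by
  refine le_csSup ⟨∑ x ∈ Λ, |f x|, ?_⟩ ⟨g, hg, hg1, rfl⟩
  rintro r ⟨k, hk, hk1, rfl⟩
  have hsum : ∑ x ∈ Λ, k x ^ 2 = 1 := by
    rw [← hk1, tsum_eq_sum]
    intro x hx
    rw [Function.notMem_support.1 fun hx' => hx (hk hx')]
    norm_num
  have hle : ∑ x ∈ Λ, f x * k x ^ 2 ≤ ∑ x ∈ Λ, |f x| := by
    refine Finset.sum_le_sum fun x hx => ?_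
    have h1 : k x ^ 2 ≤ 1 :=
      hsum ▸ Finset.single_le_sum (f := fun x => k x ^ 2) (fun y _ => sq_nonneg (k y)) hx
    calc f x * k x ^ 2 ≤ |f x| * k x ^ 2 := by gcongr; exact le_abs_self _
      _ ≤ |f x| := mul_le_of_le_one_right (abs_nonneg _) h1
  linarith [dirichlet_nonneg k]

lemma tendsto_sq_div_add_nhdsGT_zero (s : ℝ) :
    Tendsto (fun ε : ℝ => s ^ 2 / (s + ε)) (𝓝[>] 0) (𝓝 s) := by
  rcases eq_or_ne s 0 with rfl | hs
  · simp
  · have hc : ContinuousAt (fun ε : ℝ => s ^ 2 / (s + ε)) 0 :=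
      ContinuousAt.div (by fun_prop) (by fun_prop) (by simpa using hs)
    have h0 : s ^ 2 / (s + 0) = s := by
      rw [add_zero, sq, mul_self_div_self]
    have := hc.tendsto
    rw [h0] at this
    exact this.mono_left nhdsWithin_le_nhds

/-- The ground-state potentials of `s + ε` on `Λ` recover the Dirichlet form of `s`. -/
lemma tendsto_sum_groundPotential_mul_sq {d : ℕ} {Λ : Finset (Fin d → ℤ)}
    {s : (Fin d → ℤ) → ℝ} (hs : ∀ x, x ∉ Λ → s x = 0) :
    Tendsto (fun ε : ℝ => ∑ x ∈ Λ,
      groundPotential Λ (fun z => if z ∈ Λ then s z + ε else 0) x * s x ^ 2)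
      (𝓝[>] 0) (𝓝 (dirichlet s)) := by
  have hq : ∀ x, x ∉ Λ → s x ^ 2 = 0 := fun x hx => by rw [hs x hx]; norm_num
  simp only [fun h => sum_groundPotential_mul h hq]
  rw [dirichlet_eq_sum_mul hs]
  have hlim : ∀ x, Tendsto (fun ε : ℝ => if x ∈ Λ then s x + ε else 0) (𝓝[>] 0) (𝓝 (s x)) := by
    intro x
    by_cases hx : x ∈ Λ
    · have hc : Tendsto (fun ε : ℝ => s x + ε) (𝓝 0) (𝓝 (s x + 0)) :=
        (continuous_const.add continuous_id).tendsto 0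
      simpa [hx] using hc.mono_left nhdsWithin_le_nhds
    · simp [hx, hs x hx]
  refine tendsto_finsetSum _ fun x _ => tendsto_finsetSum _ fun y _ =>
    (((hlim x).sub (hlim y)).mul ?_).const_mul _
  by_cases hx : x ∈ Λ
  · simpa [hx] using tendsto_sq_div_add_nhdsGT_zero (s x)
  · simp [hx, hs x hx]

/-- the Legendre–Fenchel transform of `λ_Λ` at a probability measure `p`
supported in `Λ` equals the Dirichlet form of `√p` (the Donsker–Varadhan rate function). -/
theorem stmt11 (d : ℕ) (hd : 1 ≤ d) (Λ : Finset (Fin d → ℤ)) (hΛ : Λ.Nonempty)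
    (p : (Fin d → ℤ) → ℝ)
    (hp01 : ∀ x, 0 ≤ p x ∧ p x ≤ 1) (hpsum : (∑' x, p x) = 1)
    (hpsupp : Function.support p ⊆ ↑Λ) :
    sSup {r : ℝ | ∃ f : (Fin d → ℤ) → ℝ,
        r = ∑ x ∈ Λ, f x * p x - lamLam Λ f} =
      dirichlet (fun x => Real.sqrt (p x)) := by
  have hsq : ∀ x, Real.sqrt (p x) ^ 2 = p x := fun x => Real.sq_sqrt (hp01 x).1
  have hs : ∀ x, x ∉ Λ → Real.sqrt (p x) = 0 := fun x hx => by
    rw [Function.notMem_support.1 fun hx' => hx (hpsupp hx'), Real.sqrt_zero]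
  have hupper : ∀ r ∈ {r : ℝ | ∃ f : (Fin d → ℤ) → ℝ, r = ∑ x ∈ Λ, f x * p x - lamLam Λ f},
      r ≤ dirichlet (fun x => Real.sqrt (p x)) := by
    rintro r ⟨f, rfl⟩
    have h := le_lamLam (Λ := Λ) f (g := fun x => Real.sqrt (p x))
      (fun x hx => by_contra fun hx' => hx (hs x hx')) (by simpa only [hsq] using hpsum)
    simp only [hsq] at h
    linarith
  refine le_antisymm (Real.sSup_le hupper (dirichlet_nonneg _)) ?_
  refine le_of_tendsto (tendsto_sum_groundPotential_mul_sq hs) ?_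
  filter_upwards [self_mem_nhdsWithin] with ε hε
  have hε : 0 < ε := hε
  have hlam := lamLam_groundPotential_nonpos (Λ := Λ)
    (h := fun z => if z ∈ Λ then Real.sqrt (p z) + ε else 0)
    (fun x hx => by simp only [hx, if_true]; positivity) (fun x hx => by simp [hx])
  refine le_trans ?_ (le_csSup ⟨_, hupper⟩
    ⟨groundPotential Λ fun z => if z ∈ Λ then Real.sqrt (p z) + ε else 0, rfl⟩)
  simp only [hsq]
  linarith
end

section
/- Let E ∈ ℕ with E ≥ 2. Let q = (q_{jk})_{1≤j,k≤E−1} and r = (r_j)_{1≤j≤E−1} be families of numbers in [0,1] satisfying: (1) ∑_{j=1}^{E−1} r_j ≤ 1; (2) ∑_{k=1}^{E−1} q_{jk} ≤ r_j for every j ∈ {1,…,E−1}; (3) ∑_{j=1}^{E−1} q_{jk} ≤ r_k for every k ∈ {1,…,E−1}; (4) ∑_{j=1}^{E−1} 2·r_j − ∑_{j,k=1}^{E−1} q_{jk} ≤ 1. Then there exists a unique pair probability measure Q on {1,…,E}×{1,…,E} with equal marginals such that Q(j,k) = q_{jk} for all j,k ∈ {1,…,E−1} and Q⁽¹⁾(j)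 = r_j for all j ∈ {1,…,E−1}. -/
open scoped BigOperators

/-- The matrix of size `n + 1` with upper left block `q`, row and column marginals `r` at the
first `n` indices, and total mass `1`. -/
noncomputable def pairExtension {n : ℕ} (q : Fin n → Fin n → ℝ) (r : Fin n → ℝ) :
    Fin (n + 1) → Fin (n + 1) → ℝ :=
  Fin.snoc (α := fun _ => Fin (n + 1) → ℝ)
    (fun j => Fin.snoc (α := fun _ => ℝ) (q j) (r j - ∑ k, q j k))
    (Fin.snoc (α := fun _ => ℝ) (fun k => r k - ∑ j, q j k)
      (1 - ∑ j, 2 * r j + ∑ j, ∑ k, q j k))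

section pairExtension

variable {n : ℕ} (q : Fin n → Fin n → ℝ) (r : Fin n → ℝ)

@[simp]
theorem pairExtension_castSucc_castSucc (j k : Fin n) :
    pairExtension q r j.castSucc k.castSucc = q j k := by
  simp [pairExtension]

@[simp]
theorem pairExtension_castSucc_last (j : Fin n) :
    pairExtension q r j.castSucc (Fin.last n) = r j - ∑ k, q j k := by
  simp [pairExtension]

@[simp]
theorem pairExtension_last_castSucc (k : Fin n) :
    pairExtension q r (Fin.last n) k.castSucc = r k - ∑ j, q j k := by
  simp [pairExtension]

@[simp]
theorem pairExtension_last_last :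
    pairExtension q r (Fin.last n) (Fin.last n) =
      1 - ∑ j, 2 * r j + ∑ j, ∑ k, q j k := by
  simp [pairExtension]

theorem sum_pairExtension_castSucc (j : Fin n) :
    ∑ k, pairExtension q r j.castSucc k = r j := by
  simp [Fin.sum_univ_castSucc]

theorem sum_pairExtension_last :
    ∑ k, pairExtension q r (Fin.last n) k = 1 - ∑ j, r j := by
  simp only [Fin.sum_univ_castSucc, pairExtension_last_castSucc, pairExtension_last_last,
    Finset.sum_sub_distrib, ← Finset.mul_sum]
  rw [Finset.sum_comm]
  ring

theorem sum_sum_pairExtension : ∑ j, ∑ k, pairExtension q r j k = 1 := by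
  rw [Fin.sum_univ_castSucc]
  simp [sum_pairExtension_castSucc, sum_pairExtension_last]

theorem sum_pairExtension_eq_sum_swap (j : Fin (n + 1)) :
    ∑ k, pairExtension q r j k = ∑ k, pairExtension q r k j := by
  induction j using Fin.lastCases with
  | last =>
    rw [sum_pairExtension_last]
    simp only [Fin.sum_univ_castSucc, pairExtension_castSucc_last, pairExtension_last_last,
      Finset.sum_sub_distrib, ← Finset.mul_sum]
    ring
  | cast j =>
    rw [sum_pairExtension_castSucc]
    simp [Fin.sum_univ_castSucc]

variable {q r}

theorem pairExtension_nonneg (hq : ∀ j k, 0 ≤ q j k) (hrow : ∀ j, ∑ k, q j k ≤ r j)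
    (hcol : ∀ k, ∑ j, q j k ≤ r k) (hcorner : (∑ j, 2 * r j) - (∑ j, ∑ k, q j k) ≤ 1)
    (j k : Fin (n + 1)) : 0 ≤ pairExtension q r j k := by
  induction j using Fin.lastCases with
  | last =>
    induction k using Fin.lastCases with
    | last => rw [pairExtension_last_last]; linarith
    | cast k => simpa using hcol k
  | cast j =>
    induction k using Fin.lastCases with
    | last => simpa using hrow j
    | cast k => simpa using hq j k

theorem eq_pairExtension {Q : Fin (n + 1) → Fin (n + 1) → ℝ}
    (htotal : ∑ j, ∑ k, Q j k = 1) (hmarg : ∀ j, ∑ k, Q j k = ∑ k, Q k j)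
    (hq : ∀ j k : Fin n, Q j.castSucc k.castSucc = q j k)
    (hr : ∀ j : Fin n, ∑ k, Q j.castSucc k = r j) : Q = pairExtension q r := by
  have hcol (j : Fin n) : Q j.castSucc (Fin.last n) = r j - ∑ k, q j k := by
    have h := hr j
    simp only [Fin.sum_univ_castSucc, hq] at h
    linarith
  have hrow (k : Fin n) : Q (Fin.last n) k.castSucc = r k - ∑ j, q j k := by
    have h := (hmarg k.castSucc).symm.trans (hr k)
    simp only [Fin.sum_univ_castSucc, hq] at h
    linarith
  have hcorner : Q (Fin.last n) (Fin.last n) = 1 - ∑ j, 2 * r j + ∑ j, ∑ k, q j k := by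
    rw [Fin.sum_univ_castSucc] at htotal
    simp only [hr] at htotal
    simp only [Fin.sum_univ_castSucc, hrow, Finset.sum_sub_distrib] at htotal
    rw [Finset.sum_comm (f := fun j k => q k j)] at htotal
    rw [← Finset.mul_sum]
    linarith
  ext j k
  induction j using Fin.lastCases with
  | last => induction k using Fin.lastCases <;> simp [hrow, hcorner]
  | cast j => induction k using Fin.lastCases <;> simp [hq, hcol]

end pairExtension

theorem le_one_of_sum_sum_eq_one {ι κ : Type*} [Fintype ι] [Fintype κ] {Q : ι → κ → ℝ}
    (hQ : ∀ j k, 0 ≤ Q j k) (htotal : ∑ j, ∑ k, Q j k = 1) (j : ι) (k : κ) : Q j k ≤ 1 :=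
  calc
    Q j k ≤ ∑ k, Q j k := Finset.single_le_sum (fun k _ => hQ j k) (Finset.mem_univ k)
    _ ≤ ∑ j, ∑ k, Q j k :=
      Finset.single_le_sum (f := fun j => ∑ k, Q j k)
        (fun j _ => Finset.sum_nonneg fun k _ => hQ j k) (Finset.mem_univ j)
    _ = 1 := htotal

/-- a vector of `(E−1)²` off-corner entries and `E−1` marginal values
satisfying the compatibility conditions determines a unique pair probability measure on
`{1,…,E}²` with equal marginals. -/
theorem stmt13 (E : ℕ) (hE : 2 ≤ E)
    (q : Fin (E - 1) → Fin (E - 1) → ℝ) (r : Fin (E - 1) → ℝ)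
    (hq01 : ∀ j k, 0 ≤ q j k ∧ q j k ≤ 1)
    (hr01 : ∀ j, 0 ≤ r j ∧ r j ≤ 1)
    (h1 : ∑ j, r j ≤ 1)
    (h2 : ∀ j, ∑ k, q j k ≤ r j)
    (h3 : ∀ k, ∑ j, q j k ≤ r k)
    (h4 : (∑ j, 2 * r j) - (∑ j, ∑ k, q j k) ≤ 1) :
    ∃! Q : Fin E → Fin E → ℝ,
      (∀ j k, 0 ≤ Q j k ∧ Q j k ≤ 1) ∧
      (∑ j, ∑ k, Q j k = 1) ∧
      (∀ j, ∑ k, Q j k = ∑ k, Q k j) ∧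
      (∀ j k : Fin (E - 1),
        Q (Fin.castLE (Nat.sub_le E 1) j) (Fin.castLE (Nat.sub_le E 1) k) = q j k) ∧
      (∀ j : Fin (E - 1), ∑ k, Q (Fin.castLE (Nat.sub_le E 1) j) k = r j) := by
  obtain ⟨n, rfl⟩ : ∃ n, E = n + 1 := ⟨E - 1, by omega⟩
  have hnonneg := pairExtension_nonneg (fun j k => (hq01 j k).1) h2 h3 h4
  have htotal := sum_sum_pairExtension q r
  refine ⟨pairExtension q r, ⟨fun j k => ⟨hnonneg j k, ?_⟩, htotal,
    sum_pairExtension_eq_sum_swap q r, pairExtension_castSucc_castSucc q r,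
    sum_pairExtension_castSucc q r⟩, ?_⟩
  · exact le_one_of_sum_sum_eq_one hnonneg htotal j k
  · rintro Q ⟨-, hQ, hmarg, hblock, hrow⟩
    exact eq_pairExtension hQ hmarg hblock hrow
end

section
/- Let f : [0,1] → ℝ be defined by f(x) = −x·log x for x > 0 and f(0) = 0. Then for every Δ ∈ [0, 1/2] and every x ∈ [0, 1−Δ], one has |f(x) − f(x+Δ)| ≤ −Δ·log Δ (with the convention that the right-hand side is 0 when Δ = 0). -/
/-- The function `-x log x` is subadditive on the nonnegative reals. -/
theorem negMulLog_add_le {x y : ℝ} (hx : 0 ≤ x) (hy : 0 ≤ y) :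
    Real.negMulLog (x + y) ≤ Real.negMulLog x + Real.negMulLog y := by
  have key : ∀ {a b : ℝ}, 0 ≤ a → 0 ≤ b → a * Real.log a ≤ a * Real.log (a + b) := by
    intro a b ha hb
    rcases ha.eq_or_lt with rfl | ha
    · simp
    · exact mul_le_mul_of_nonneg_left (Real.log_le_log ha (by linarith)) ha.le
  have h₁ := key hx hy
  have h₂ := key hy hx
  rw [add_comm y x] at h₂
  simp only [Real.negMulLog]
  linarith

/-- On `[0, 1/2]`, the function `-x log x` dominates its reflection about `1/2`. -/
theorem negMulLog_one_sub_le {x : ℝ} (hx₀ : 0 ≤ x) (hx : x ≤ 1 / 2) :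
    Real.negMulLog (1 - x) ≤ Real.negMulLog x := by
  rcases hx₀.eq_or_lt with rfl | hx₀
  · simp
  have hpos : 0 < 1 - x := by linarith
  have h := strictConcaveOn_log_Ioi.concaveOn.2 (Set.mem_Ioi.2 hx₀)
    (Set.mem_Ioi.2 one_pos) (div_nonneg hx₀.le hpos.le)
    (sub_nonneg.2 ((div_le_one hpos).2 (by linarith : x ≤ 1 - x))) (by ring)
  have hcomb : x / (1 - x) * x + (1 - x / (1 - x)) * 1 = 1 - x := by
    field_simp
    ring
  simp only [smul_eq_mul, Real.log_one, mul_zero, add_zero] at h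
  rw [hcomb, div_mul_eq_mul_div, div_le_iff₀ hpos] at h
  simp only [Real.negMulLog]
  linarith

/-- For a concave function, the sum of the values at the endpoints of an interval is at most the
sum of the values at two points of it that are symmetric about the midpoint. -/
theorem ConcaveOn.add_le_add_of_symmetric {s : Set ℝ} {f : ℝ → ℝ} (hf : ConcaveOn ℝ s f)
    {a b d : ℝ} (ha : a ∈ s) (hb : b ∈ s) (hd : 0 ≤ d) (hdb : d ≤ b - a) :
    f a + f b ≤ f (a + d) + f (b - d) := by
  rcases (hd.trans hdb).eq_or_lt with hab | hab
  · obtain rfl : d = 0 := by linarith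
    simp
  have ht₀ : 0 ≤ d / (b - a) := div_nonneg hd hab.le
  have ht₁ : 0 ≤ 1 - d / (b - a) := sub_nonneg.2 ((div_le_one hab).2 hdb)
  have h₁ := hf.2 ha hb ht₁ ht₀ (by ring)
  have h₂ := hf.2 ha hb ht₀ ht₁ (by ring)
  have hd' : d / (b - a) * (b - a) = d := div_mul_cancel₀ d hab.ne'
  simp only [smul_eq_mul] at h₁ h₂
  rw [show (1 - d / (b - a)) * a + d / (b - a) * b = a + d by linear_combination hd'] at h₁
  rw [show d / (b - a) * a + (1 - d / (b - a)) * b = b - d by linear_combination -hd'] at h₂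
  linarith

/-- for `f(x) = −x·log x` (with `f(0)=0`), `Δ ∈ [0,1/2]` and
`x ∈ [0,1−Δ]`, one has `|f(x) − f(x+Δ)| ≤ −Δ·log Δ`. -/
theorem stmt15 (Δ : ℝ) (hΔ0 : 0 ≤ Δ) (hΔ : Δ ≤ 1 / 2)
    (x : ℝ) (hx0 : 0 ≤ x) (hx : x ≤ 1 - Δ) :
    |(-(x * Real.log x)) - (-((x + Δ) * Real.log (x + Δ)))| ≤
      -(Δ * Real.log Δ) := by
  have hsub := negMulLog_add_le hx0 hΔ0
  have hrefl := negMulLog_one_sub_le hΔ0 hΔ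
  have hconc := Real.concaveOn_negMulLog.add_le_add_of_symmetric (Set.mem_Ici.2 hx0)
    (Set.mem_Ici.2 zero_le_one) hΔ0 (by linarith)
  rw [Real.negMulLog_one] at hconc
  simp only [← neg_mul]
  change |Real.negMulLog x - Real.negMulLog (x + Δ)| ≤ Real.negMulLog Δ
  rw [abs_le]
  constructor <;> linarith
end

section
/- For every u ∈ [−1, 1], the supremum over a ∈ ℝ of the quantity a·u − (−1/2 + √(1/4 + a²)) equals (1/2)·(1 − √(1 − u²)). That is, sup_{a∈ℝ} ( a·u + 1/2 − √(1/4 + a²) ) = (1/2)·(1 − √(1 − u²)). -/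
/-- the Legendre–Fenchel transform of `a ↦ −1/2 + √(1/4 + a²)` at
`u ∈ [−1,1]` equals `(1/2)(1 − √(1 − u²))`. -/
theorem stmt16 (u : ℝ) (hul : -1 ≤ u) (huu : u ≤ 1) :
    (⨆ a : ℝ, (a * u + 1 / 2 - Real.sqrt (1 / 4 + a ^ 2))) =
      1 / 2 * (1 - Real.sqrt (1 - u ^ 2)) := by
  have hs_sq : Real.sqrt (1 - u ^ 2) ^ 2 = 1 - u ^ 2 := Real.sq_sqrt (by nlinarith)
  have hs_nonneg := Real.sqrt_nonneg (1 - u ^ 2)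
  set s := Real.sqrt (1 - u ^ 2)
  apply ciSup_eq_of_forall_le_of_forall_lt_exists_gt
  · intro a
    have h : a * u + s / 2 ≤ Real.sqrt (1 / 4 + a ^ 2) := by
      apply Real.le_sqrt_of_sq_le
      linear_combination sq_nonneg (a * s - u / 2) + (a ^ 2 + 1 / 4) * hs_sq
    linarith
  · intro w hw
    rcases hs_nonneg.eq_or_lt with hs | hs
    · -- the supremum is not attained when `u = ±1`
      rw [← hs] at hs_sq hw
      have he : 0 < 1 / 2 - w := by linarith
      set e := 1 / 2 - w with he_def
      have ht : 1 / (4 * e) * e = 1 / 4 := by field_simp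
      have ht_pos : 0 < 1 / (4 * e) := by positivity
      set t := 1 / (4 * e)
      refine ⟨t * u, ?_⟩
      have h : Real.sqrt (1 / 4 + (t * u) ^ 2) ≤ t + e / 2 := by
        apply Real.sqrt_le_iff.mpr ⟨by positivity, ?_⟩
        linear_combination sq_nonneg (e / 2) - ht + t ^ 2 * hs_sq
      have hu : t * u * u = t := by linear_combination t * hs_sq
      linarith
    · refine ⟨u / (2 * s), hw.trans_eq ?_⟩
      have h : 1 / 4 + (u / (2 * s)) ^ 2 = (1 / (2 * s)) ^ 2 := by
        field_simp
        linear_combination 4 * hs_sq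
      rw [h, Real.sqrt_sq (by positivity)]
      field_simp
      linear_combination -hs_sq
end
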